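/- Let D be a connected digraph with more than one end. Then D is C-homogeneous of Type I if and only if one of the following holds: (1) the underlying undirected graph of D is a tree and all vertices of D have the same in-degree and all vertices have the same out-degree; or (2) there exist cardinals κ and λ with λ ≥ 2 and κ either equal to 3 or infinite such that every block (maximal connected subgraph without a cutvertex) of the underlying undirected graph of D spans in D a homogeneous tournament on κ vertices, all these tournaments are pairwise isomorphic, and every vertex of D lies in exactly λ blocks. -/

import Mathlib

open Set

universe u

/-- The underlying undirected graph of a digraph given by its edge relation. -/
def UG {V : Type u} (E : V → V → Prop) : SimpleGraph V := SimpleGraph.fromRel E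

/-- `E` is a digraph edge relation: irreflexive and antisymmetric. -/
def IsDigraph {V : Type u} (E : V → V → Prop) : Prop :=
  (∀ x, ¬ E x x) ∧ ∀ x y, E x y → ¬ E y x

/-- A ray in a graph: a one-way infinite path. -/
def IsRay {V : Type u} (G : SimpleGraph V) (r : ℕ → V) : Prop :=
  Function.Injective r ∧ ∀ n, G.Adj (r n) (r (n + 1))

/-- A sequence is eventually in a set. -/
def EventuallyIn {V : Type u} (r : ℕ → V) (C : Set V) : Prop :=
  ∃ N, ∀ n, N ≤ n → r n ∈ C

/-- `C` is a connected component of the subgraph of `G` induced on `W`: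
a maximal connected subset of `W`. -/
def IsCompOf {V : Type u} (G : SimpleGraph V) (C W : Set V) : Prop :=
  C.Nonempty ∧ C ⊆ W ∧ (G.induce C).Connected ∧
    ∀ C', C ⊆ C' → C' ⊆ W → (G.induce C').Connected → C' = C

/-- Two rays are equivalent if for every finite vertex set `S` they lie eventually
in the same component of the graph minus `S`. -/
def RayEquiv {V : Type u} (G : SimpleGraph V) (r r' : ℕ → V) : Prop :=
  ∀ S : Finset V, ∃ C : Set V, IsCompOf G C {v | v ∉ S} ∧
    EventuallyIn r C ∧ EventuallyIn r' C

/-- The graph has more than one end: two inequivalent rays. -/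
def MoreThanOneEnd {V : Type u} (G : SimpleGraph V) : Prop :=
  ∃ r r' : ℕ → V, IsRay G r ∧ IsRay G r' ∧ ¬ RayEquiv G r r'

/-- The graph has infinitely many ends: arbitrarily large families of pairwise
inequivalent rays. -/
def InfinitelyManyEnds {V : Type u} (G : SimpleGraph V) : Prop :=
  ∀ n : ℕ, ∃ f : Fin n → (ℕ → V), (∀ i, IsRay G (f i)) ∧
    ∀ i j, i ≠ j → ¬ RayEquiv G (f i) (f j)

/-- A separation of a graph: a pair of vertex sets covering `V` such that every
edge lies within one side. -/
def IsSeparation {V : Type u} (G : SimpleGraph V) (c : Set V × Set V) : Prop :=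
  c.1 ∪ c.2 = univ ∧ ∀ x y, G.Adj x y → (x ∈ c.1 ∧ y ∈ c.1) ∨ (x ∈ c.2 ∧ y ∈ c.2)

/-- The order of a separation: the number of vertices in its separator. -/
noncomputable def sepOrder {V : Type u} (c : Set V × Set V) : ℕ := (c.1 ∩ c.2).ncard

/-- The neighbourhood of a vertex set. -/
def Nbhd {V : Type u} (G : SimpleGraph V) (A : Set V) : Set V :=
  {v | v ∉ A ∧ ∃ u ∈ A, G.Adj u v}

/-- The separation `(A, ∼)`. -/
def tildeSep {V : Type u} (G : SimpleGraph V) (A : Set V) : Set V × Set V :=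
  (A, Aᶜ ∪ Nbhd G Aᶜ)

/-- `S` separates the wings of the separation `c`: every walk from one wing to
the other meets `S`. -/
def SeparatesWings {V : Type u} (G : SimpleGraph V) (c : Set V × Set V) (S : Set V) : Prop :=
  ∀ a ∈ c.1 \ c.2, ∀ b ∈ c.2 \ c.1, ∀ w : G.Walk a b, ∃ v ∈ w.support, v ∈ S

/-- A separation of finite order with non-empty wings is essential if its first wing is
connected and no proper subset of the separator separates the wings. -/
def IsEssential {V : Type u} (G : SimpleGraph V) (c : Set V × Set V) : Prop :=
  IsSeparation G c ∧ (c.1 ∩ c.2).Finite ∧ (c.1 \ c.2).Nonempty ∧ (c.2 \ c.1).Nonempty ∧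
  (G.induce (c.1 \ c.2)).Connected ∧
  ∀ S, S ⊂ c.1 ∩ c.2 → ¬ SeparatesWings G c S

/-- `C` is a wing of some separation in `𝒞`. -/
def IsWingOf {V : Type u} (𝒞 : Set (Set V × Set V)) (C : Set V) : Prop :=
  ∃ d ∈ 𝒞, C = d.1 \ d.2 ∨ C = d.2 \ d.1

/-- A cut system. -/
def IsCutSystem {V : Type u} (G : SimpleGraph V) (𝒞 : Set (Set V × Set V)) : Prop :=
  𝒞.Nonempty ∧ (∀ c ∈ 𝒞, IsEssential G c) ∧
  (∀ c ∈ 𝒞, ∃ d ∈ 𝒞, d.1 ⊆ c.2) ∧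
  (∀ c ∈ 𝒞, ∀ C : Set V, IsCompOf G C (c.2 \ c.1) →
    (∃ d ∈ 𝒞, d.1 \ d.2 ⊆ C) → tildeSep G (C ∪ Nbhd G C) ∈ 𝒞) ∧
  (∀ c ∈ 𝒞, ∀ c' ∈ 𝒞, ∃ C₁ C₂ : Set V,
    ((IsCompOf G C₁ ((c.1 \ c.2) ∩ (c'.1 \ c'.2)) ∧
      IsCompOf G C₂ ((c.2 \ c.1) ∩ (c'.2 \ c'.1))) ∨
     (IsCompOf G C₁ ((c.2 \ c.1) ∩ (c'.1 \ c'.2)) ∧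
      IsCompOf G C₂ ((c.1 \ c.2) ∩ (c'.2 \ c'.1)))) ∧
    IsWingOf 𝒞 C₁ ∧ IsWingOf 𝒞 C₂)

/-- Pick a side of a separation. -/
def pickSide {V : Type u} (c : Set V × Set V) : Bool → Set V
  | false => c.1
  | true => c.2

/-- Two cuts are nested (with respect to the cut system `𝒞`). -/
def NestedPair {V : Type u} (G : SimpleGraph V) (𝒞 : Set (Set V × Set V))
    (c d : Set V × Set V) : Prop :=
  ∃ i j : Bool,
    ((¬ ∃ C, IsCompOf G C ((tildeSep G (pickSide c i ∩ pickSide d j)).1 \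
        (tildeSep G (pickSide c i ∩ pickSide d j)).2) ∧
        tildeSep G (C ∪ Nbhd G C) ∈ 𝒞) ∨
     (¬ ∃ C, IsCompOf G C ((tildeSep G (pickSide c i ∩ pickSide d j)).2 \
        (tildeSep G (pickSide c i ∩ pickSide d j)).1) ∧
        tildeSep G (C ∪ Nbhd G C) ∈ 𝒞)) ∧
    (c.1 ∩ c.2) ∪ (d.1 ∩ d.2) ⊆ pickSide c (!i) ∩ pickSide d (!j)

/-- A cut system is nested if each two of its cuts are nested. -/
def IsNestedSystem {V : Type u} (G : SimpleGraph V) (𝒞 : Set (Set V × Set V)) : Prop :=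
  ∀ c ∈ 𝒞, ∀ d ∈ 𝒞, NestedPair G 𝒞 c d

/-- `S` is a `𝒞`-separator. -/
def IsSeparatorOf {V : Type u} (𝒞 : Set (Set V × Set V)) (S : Set V) : Prop :=
  ∃ c ∈ 𝒞, c.1 ∩ c.2 = S

/-- A vertex set contains an end: some ray lies in it. -/
def ContainsEnd {V : Type u} (G : SimpleGraph V) (A : Set V) : Prop :=
  ∃ r : ℕ → V, IsRay G r ∧ ∀ n, r n ∈ A

/-- A basic cut system. -/
def IsBasic {V : Type u} (G : SimpleGraph V) (𝒞 : Set (Set V × Set V)) : Prop :=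
  IsCutSystem G 𝒞 ∧
  (∀ c ∈ 𝒞, ∀ d ∈ 𝒞, ¬ sepOrder c < sepOrder d) ∧
  IsNestedSystem G 𝒞 ∧
  (∀ φ : G ≃g G, ∀ c ∈ 𝒞, ((⇑φ '' c.1, ⇑φ '' c.2) : Set V × Set V) ∈ 𝒞) ∧
  (∀ S S' : Set V, IsSeparatorOf 𝒞 S → IsSeparatorOf 𝒞 S' → ∃ φ : G ≃g G, ⇑φ '' S = S') ∧
  (∀ c ∈ 𝒞, ContainsEnd G c.1 ∧ ContainsEnd G c.2 ∧
    ¬ ∃ d : Set V × Set V, IsSeparation G d ∧ (d.1 ∩ d.2).Finite ∧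
      (d.1 ∩ d.2).ncard < sepOrder c ∧ ContainsEnd G d.1 ∧ ContainsEnd G d.2)

/-- The defining property of a `𝒞`-block. -/
def BlockProp {V : Type u} (𝒞 : Set (Set V × Set V)) (X : Set V) : Prop :=
  (∀ c ∈ 𝒞, (X ⊆ c.1 ∨ X ⊆ c.2) ∧ ¬ (X ⊆ c.1 ∧ X ⊆ c.2)) ∧
  ∃ c ∈ 𝒞, X ⊆ c.1 ∧ c.1 ∩ c.2 ⊆ X

/-- A `𝒞`-block: a maximal vertex set with the block property. -/
def IsCBlock {V : Type u} (𝒞 : Set (Set V × Set V)) (X : Set V) : Prop :=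
  BlockProp 𝒞 X ∧ ∀ X', X ⊆ X' → BlockProp 𝒞 X' → X' = X

/-- A digraph is C-homogeneous: every isomorphism between finite induced
subdigraphs with connected underlying graphs extends to an automorphism. -/
def DigraphCHom {V : Type u} (E : V → V → Prop) : Prop :=
  ∀ (X Y : Set V), X.Finite → Y.Finite → ((UG E).induce X).Connected →
  ∀ φ : X ≃ Y, (∀ a b : X, E a.1 b.1 ↔ E (φ a).1 (φ b).1) →
  ∃ ψ : Equiv.Perm V, (∀ x y, E (ψ x) (ψ y) ↔ E x y) ∧ ∀ a : X, ψ a.1 = (φ a).1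

/-- A graph is C-homogeneous: every isomorphism between finite connected induced
subgraphs extends to an automorphism. -/
def GraphCHom {V : Type u} (G : SimpleGraph V) : Prop :=
  ∀ (X Y : Set V), X.Finite → Y.Finite → (G.induce X).Connected →
  ∀ φ : X ≃ Y, (∀ a b : X, G.Adj a.1 b.1 ↔ G.Adj (φ a).1 (φ b).1) →
  ∃ ψ : G ≃g G, ∀ a : X, ψ a.1 = (φ a).1

/-- The digraph contains a triangle: three pairwise adjacent vertices. -/
def HasTriangle {V : Type u} (E : V → V → Prop) : Prop :=
  ∃ x y z : V, (UG E).Adj x y ∧ (UG E).Adj y z ∧ (UG E).Adj x z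

/-- An `n`-arc: a directed path `p 0, p 1, …, p n`. -/
def IsArc {V : Type u} (E : V → V → Prop) (n : ℕ) (p : ℕ → V) : Prop :=
  (∀ i j, i ≤ n → j ≤ n → p i = p j → i = j) ∧ ∀ i < n, E (p i) (p (i + 1))

/-- A digraph is highly-arc-transitive: for every `n`, its automorphism group acts
transitively on `n`-arcs. -/
def HighlyArcTransitive {V : Type u} (E : V → V → Prop) : Prop :=
  ∀ n : ℕ, ∀ p q : ℕ → V, IsArc E n p → IsArc E n q →
  ∃ ψ : Equiv.Perm V, (∀ x y, E (ψ x) (ψ y) ↔ E x y) ∧ ∀ i ≤ n, ψ (p i) = q i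

/-- An alternating walk `w 0, …, w n` in a digraph. -/
def IsAltWalk {V : Type u} (E : V → V → Prop) (n : ℕ) (w : ℕ → V) : Prop :=
  (∀ i < n, E (w i) (w (i + 1)) ∨ E (w (i + 1)) (w i)) ∧
  ∀ i, i + 2 ≤ n → (E (w i) (w (i + 1)) ↔ E (w (i + 2)) (w (i + 1)))

/-- The edge `e` lies on the walk `w 0, …, w n` (in either direction). -/
def EdgeOnWalk {V : Type u} (n : ℕ) (w : ℕ → V) (e : V × V) : Prop :=
  ∃ i < n, (w i = e.1 ∧ w (i + 1) = e.2) ∨ (w i = e.2 ∧ w (i + 1) = e.1)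

/-- Two edges are reachable from each other: they lie on a common alternating walk. -/
def Reach {V : Type u} (E : V → V → Prop) (e f : V × V) : Prop :=
  ∃ n w, IsAltWalk E n w ∧ EdgeOnWalk n w e ∧ EdgeOnWalk n w f

/-- The edge relation of the reachability digraph `Δ_e`. -/
def DeltaRel {V : Type u} (E : V → V → Prop) (e : V × V) : V → V → Prop :=
  fun x y => E x y ∧ Reach E e (x, y)

/-- The underlying undirected graph of the reachability digraph `Δ_e`. -/
def DeltaGraph {V : Type u} (E : V → V → Prop) (e : V × V) : SimpleGraph V :=
  UG (DeltaRel E e)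

/-- Tails of edges of `𝒜(e)`. -/
def Tails {V : Type u} (E : V → V → Prop) (e : V × V) : Set V :=
  {x | ∃ y, DeltaRel E e x y}

/-- Heads of edges of `𝒜(e)`. -/
def Heads {V : Type u} (E : V → V → Prop) (e : V × V) : Set V :=
  {y | ∃ x, DeltaRel E e x y}

/-- The set of descendants of a vertex. -/
def Descendants {V : Type u} (E : V → V → Prop) (x : V) : Set V :=
  {y | ∃ n p, IsArc E n p ∧ p 0 = x ∧ p n = y}

/-- `(X, Y)` is a bipartition of the graph `G`. -/
def IsBipartition {V : Type u} (G : SimpleGraph V) (X Y : Set V) : Prop :=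
  X ∪ Y = univ ∧ Disjoint X Y ∧
  ∀ a b, G.Adj a b → (a ∈ X ∧ b ∈ Y) ∨ (a ∈ Y ∧ b ∈ X)

/-- `G` with sides `X`, `Y` is C-homogeneous bipartite: every isomorphism between
finite connected induced subgraphs preserving the sides extends to a side-preserving
automorphism. -/
def BipCHom {V : Type u} (G : SimpleGraph V) (X Y : Set V) : Prop :=
  ∀ (A B : Set V), A.Finite → B.Finite → (G.induce A).Connected →
  ∀ φ : A ≃ B, (∀ a b : A, G.Adj a.1 b.1 ↔ G.Adj (φ a).1 (φ b).1) →
  (∀ a : A, a.1 ∈ X ↔ (φ a).1 ∈ X) → (∀ a : A, a.1 ∈ Y ↔ (φ a).1 ∈ Y) →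
  ∃ ψ : G ≃g G, (∀ v, v ∈ X ↔ ψ v ∈ X) ∧ (∀ v, v ∈ Y ↔ ψ v ∈ Y) ∧
    ∀ a : A, ψ a.1 = (φ a).1

/-- `G` with sides `X`, `Y` is homogeneous bipartite: every isomorphism between
finite induced subgraphs preserving the sides extends to a side-preserving
automorphism. -/
def BipHom {V : Type u} (G : SimpleGraph V) (X Y : Set V) : Prop :=
  ∀ (A B : Set V), A.Finite → B.Finite →
  ∀ φ : A ≃ B, (∀ a b : A, G.Adj a.1 b.1 ↔ G.Adj (φ a).1 (φ b).1) →
  (∀ a : A, a.1 ∈ X ↔ (φ a).1 ∈ X) → (∀ a : A, a.1 ∈ Y ↔ (φ a).1 ∈ Y) →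
  ∃ ψ : G ≃g G, (∀ v, v ∈ X ↔ ψ v ∈ X) ∧ (∀ v, v ∈ Y ↔ ψ v ∈ Y) ∧
    ∀ a : A, ψ a.1 = (φ a).1

/-- `G` with sides `X`, `Y` is generic bipartite. -/
def GenericBip {V : Type u} (G : SimpleGraph V) (X Y : Set V) : Prop :=
  (∀ U W : Set V, U ⊆ X → W ⊆ X → U.Finite → W.Finite → Disjoint U W →
    ∃ v ∈ Y, (∀ u ∈ U, G.Adj v u) ∧ ∀ w ∈ W, ¬ G.Adj v w) ∧
  (∀ U W : Set V, U ⊆ Y → W ⊆ Y → U.Finite → W.Finite → Disjoint U W →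
    ∃ v ∈ X, (∀ u ∈ U, G.Adj v u) ∧ ∀ w ∈ W, ¬ G.Adj v w)

/-- The induced subdigraph on `B` is a tournament: any two distinct vertices of
`B` are joined by a directed edge. -/
def IsTournamentOn {V : Type u} (E : V → V → Prop) (B : Set V) : Prop :=
  ∀ a ∈ B, ∀ b ∈ B, a ≠ b → E a b ∨ E b a

/-- The induced subdigraph on `B` is homogeneous: every isomorphism between two
finite induced subdigraphs of it extends to an automorphism of it. -/
def HomogeneousOn {V : Type u} (E : V → V → Prop) (B : Set V) : Prop :=
  ∀ (X Y : Set B), X.Finite → Y.Finite → ∀ φ : X ≃ Y,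
    (∀ a b : X, E a.1.1 b.1.1 ↔ E (φ a).1.1 (φ b).1.1) →
    ∃ ψ : Equiv.Perm B, (∀ x y : B, E (ψ x).1 (ψ y).1 ↔ E x.1 y.1) ∧
      ∀ a : X, ψ a.1 = (φ a).1

/-- `B` is (the vertex set of) a block of `G`: a maximal connected induced
subgraph without a cutvertex. -/
def IsBlockOf {V : Type u} (G : SimpleGraph V) (B : Set V) : Prop :=
  B.Nonempty ∧ (G.induce B).Connected ∧
  (∀ v ∈ B, (G.induce (B \ {v})).Preconnected) ∧
  ∀ B', B ⊆ B' → (G.induce B').Connected →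
    (∀ v ∈ B', (G.induce (B' \ {v})).Preconnected) → B' = B

namespace CHom

/-- `y` can be reached from `x` by a walk of length `n` inside `A`. -/
inductive JL {V : Type u} (G : SimpleGraph V) (A : Set V) : ℕ → V → V → Prop
  | refl {x : V} (hx : x ∈ A) : JL G A 0 x x
  | cons {n : ℕ} {x y z : V} (hx : x ∈ A) (hxy : G.Adj x y) (h : JL G A n y z) :
      JL G A (n + 1) x z

/-- `x` and `y` are joined by a walk inside `A`. -/
def Joined {V : Type u} (G : SimpleGraph V) (A : Set V) (x y : V) : Prop :=
  ∃ n, JL G A n x y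

section Walks

variable {V : Type u} {G : SimpleGraph V} {A A' : Set V} {x y z : V} {m n : ℕ}

theorem JL.left_mem (h : JL G A n x y) : x ∈ A := by cases h <;> assumption

theorem JL.right_mem (h : JL G A n x y) : y ∈ A := by
  induction h <;> assumption

theorem JL.trans (h : JL G A m x y) (h' : JL G A n y z) : JL G A (m + n) x z := by
  induction h with
  | refl hx => simpa using h'
  | cons hx hxy _ ih =>
    rw [Nat.add_right_comm]
    exact .cons hx hxy (ih h')

theorem JL.single (hx : x ∈ A) (hy : y ∈ A) (h : G.Adj x y) : JL G A 1 x y :=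
  .cons hx h (.refl hy)

theorem JL.symm (h : JL G A n x y) : JL G A n y x := by
  induction h with
  | refl hx => exact .refl hx
  | cons hx hxy h ih => exact ih.trans (.single h.left_mem hx hxy.symm)

theorem JL.mono (hA : A ⊆ A') (h : JL G A n x y) : JL G A' n x y := by
  induction h with
  | refl hx => exact .refl (hA hx)
  | cons hx hxy _ ih => exact .cons (hA hx) hxy ih

theorem JL.eq_of_zero (h : JL G A 0 x y) : x = y := by cases h; rfl

theorem JL.exists_fun (h : JL G A n x y) :
    ∃ f : ℕ → V, f 0 = x ∧ f n = y ∧ (∀ i ≤ n, f i ∈ A) ∧ ∀ i < n, G.Adj (f i) (f (i + 1)) := by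
  induction h with
  | @refl x hx =>
    exact ⟨fun _ => x, rfl, rfl, fun _ _ => hx, fun i hi => absurd hi (Nat.not_lt_zero i)⟩
  | @cons n x y z hx hxy _ ih =>
    obtain ⟨f, h0, hn, hA, hadj⟩ := ih
    refine ⟨fun i => Nat.casesOn i x f, rfl, hn, ?_, ?_⟩
    · rintro (_ | i) hi
      · exact hx
      · exact hA i (by omega)
    · rintro (_ | i) hi
      · simpa [h0] using hxy
      · exact hadj i (by omega)

theorem JL.of_fun {f : ℕ → V} {a b : ℕ} (hab : a ≤ b) (hA : ∀ i, a ≤ i → i ≤ b → f i ∈ A)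
    (hadj : ∀ i, a ≤ i → i < b → G.Adj (f i) (f (i + 1))) : JL G A (b - a) (f a) (f b) := by
  induction b, hab using Nat.le_induction with
  | base => simpa using JL.refl (hA a le_rfl le_rfl)
  | succ b hab ih =>
    have h := (ih (fun i h h' => hA i h (by omega)) (fun i h h' => hadj i h (by omega))).trans
      (.single (hA b hab (by omega)) (hA (b + 1) (by omega) le_rfl) (hadj b hab (by omega)))
    rwa [show b + 1 - a = b - a + 1 by omega]

theorem Joined.refl (hx : x ∈ A) : Joined G A x x := ⟨0, .refl hx⟩

theorem Joined.symm (h : Joined G A x y) : Joined G A y x := h.imp fun _ h => h.symm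

theorem Joined.trans (h : Joined G A x y) (h' : Joined G A y z) : Joined G A x z := by
  obtain ⟨m, h⟩ := h
  obtain ⟨n, h'⟩ := h'
  exact ⟨_, h.trans h'⟩

theorem Joined.mono (hA : A ⊆ A') (h : Joined G A x y) : Joined G A' x y :=
  h.imp fun _ h => h.mono hA

theorem Joined.of_adj (hx : x ∈ A) (hy : y ∈ A) (h : G.Adj x y) : Joined G A x y :=
  ⟨1, .single hx hy h⟩

theorem Joined.right_mem (h : Joined G A x y) : y ∈ A := h.elim fun _ h => h.right_mem

theorem Joined.of_fun {f : ℕ → V} {a b : ℕ} (hab : a ≤ b) (hA : ∀ i, a ≤ i → i ≤ b → f i ∈ A)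
    (hadj : ∀ i, a ≤ i → i < b → G.Adj (f i) (f (i + 1))) : Joined G A (f a) (f b) :=
  ⟨_, .of_fun hab hA hadj⟩

/-- Every vertex of a walk inside `A` is joined to its start inside the set of those vertices. -/
theorem Joined.inside (h : Joined G A x y) : Joined G {v | Joined G A x v} x y := by
  obtain ⟨n, h⟩ := h
  obtain ⟨f, rfl, rfl, hA, hadj⟩ := h.exists_fun
  exact .of_fun (Nat.zero_le n)
    (fun i _ hi => .of_fun (Nat.zero_le i) (fun j _ hj => hA j (by omega))
      (fun j _ hj => hadj j (by omega)))
    (fun i _ hi => hadj i hi)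

theorem joined_iff_reachable {x y : A} :
    (G.induce A).Reachable x y ↔ Joined G A x.1 y.1 := by
  constructor
  · rintro ⟨p⟩
    induction p with
    | nil => exact .refl (Subtype.property _)
    | cons h _ ih => exact (Joined.of_adj (Subtype.property _) (Subtype.property _) h).trans ih
  · rintro ⟨n, h⟩
    obtain ⟨x, hx⟩ := x
    obtain ⟨y, hy⟩ := y
    simp only at h
    induction h with
    | refl => exact .refl _
    | cons hx hxy h ih =>
      exact (SimpleGraph.Adj.reachable (G := G.induce A) (v := ⟨_, h.left_mem⟩)
        (by simpa using hxy)).trans (ih h.left_mem hy)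

theorem preconnected_iff : (G.induce A).Preconnected ↔ ∀ x ∈ A, ∀ y ∈ A, Joined G A x y :=
  ⟨fun h x hx y hy => joined_iff_reachable.1 (h ⟨x, hx⟩ ⟨y, hy⟩),
    fun h x y => joined_iff_reachable.2 (h x.1 x.2 y.1 y.2)⟩

theorem connected_iff :
    (G.induce A).Connected ↔ A.Nonempty ∧ ∀ x ∈ A, ∀ y ∈ A, Joined G A x y := by
  rw [SimpleGraph.connected_iff, preconnected_iff, Set.nonempty_coe_sort, and_comm]

theorem Joined.of_reachable (h : G.Reachable x y) : Joined G univ x y := by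
  obtain ⟨p⟩ := h
  induction p with
  | nil => exact .refl (mem_univ _)
  | cons h _ ih => exact (Joined.of_adj (mem_univ _) (mem_univ _) h).trans ih

theorem joined_univ (h : G.Connected) (x y : V) : Joined G univ x y :=
  .of_reachable (h.preconnected x y)

theorem joined_star {i : V} (hA : ∀ a ∈ A, a = i ∨ G.Adj i a) (hi : i ∈ A) :
    ∀ x ∈ A, ∀ y ∈ A, Joined G A x y := by
  have h : ∀ x ∈ A, Joined G A i x := fun x hx => by
    rcases hA x hx with rfl | h
    · exact .refl hx
    · exact .of_adj hi hx h
  exact fun x hx y hy => (h x hx).symm.trans (h y hy)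

/-- A set that is closed under stepping to neighbours inside `A` contains everything joined to
one of its elements. -/
theorem Joined.induct {P : V → Prop} (h : Joined G A x y) (hx : P x)
    (step : ∀ u v, u ∈ A → v ∈ A → G.Adj u v → P u → P v) : P y := by
  obtain ⟨n, h⟩ := h
  induction h with
  | refl => exact hx
  | cons hx' hxy h ih => exact ih (step _ _ hx' h.left_mem hxy hx)

/-- `p 0, …, p n` is an induced path. -/
def IndPath (G : SimpleGraph V) (n : ℕ) (p : ℕ → V) : Prop :=
  ∀ i j, i < j → j ≤ n → p i ≠ p j ∧ (G.Adj (p i) (p j) ↔ i + 1 = j)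

theorem exists_indPath (h : Joined G A x y) :
    ∃ n p, p 0 = x ∧ p n = y ∧ (∀ i ≤ n, p i ∈ A) ∧ IndPath G n p ∧
      ∀ m, JL G A m x y → n ≤ m := by
  classical
  let n := Nat.find h
  obtain ⟨f, h0, hn, hA, hadj⟩ := (Nat.find_spec h).exists_fun
  have hmin : ∀ m, JL G A m x y → n ≤ m := fun m hm => Nat.find_min' h hm
  have seg : ∀ i j, i ≤ j → j ≤ n → JL G A (j - i) (f i) (f j) := fun i j hij hj =>
    .of_fun hij (fun k _ hk => hA k (hk.trans hj)) (fun k _ hk => hadj k (hk.trans_le hj))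
  refine ⟨n, f, h0, hn, hA, fun i j hij hj => ⟨fun heq => ?_, fun h' => ?_, fun h' => ?_⟩, hmin⟩
  · have h1 := seg 0 i (Nat.zero_le _) (by omega)
    have h2 := seg j n hj le_rfl
    rw [heq] at h1
    have := hmin _ (h0 ▸ hn ▸ h1.trans h2)
    omega
  · have h1 := seg 0 i (Nat.zero_le _) (by omega)
    have h2 := seg j n hj le_rfl
    have := hmin _ (h0 ▸ hn ▸ (h1.trans (.single (hA i (by omega)) (hA j hj) h')).trans h2)
    omega
  · subst h'
    exact hadj i (by omega)

theorem IndPath.adj {p : ℕ → V} (h : IndPath G n p) {i : ℕ} (hi : i < n) :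
    G.Adj (p i) (p (i + 1)) := ((h i (i + 1) (by omega) (by omega)).2).2 rfl

theorem IndPath.mono {p : ℕ → V} (h : IndPath G n p) (hm : m ≤ n) : IndPath G m p :=
  fun i j hij hj => h i j hij (by omega)

end Walks

section Homogeneous

variable {V : Type u} {R : V → V → Prop} {G : SimpleGraph V}

theorem UG_adj (G : SimpleGraph V) : UG G.Adj = G := by
  ext x y
  rw [UG, SimpleGraph.fromRel_adj]
  constructor
  · rintro ⟨_, h | h⟩
    exacts [h, h.symm]
  · exact fun h => ⟨h.ne, Or.inl h⟩

theorem UG_adj_iff (hR : ∀ x, ¬ R x x) {x y : V} : (UG R).Adj x y ↔ R x y ∨ R y x := by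
  rw [UG, SimpleGraph.fromRel_adj]
  exact ⟨fun h => h.2, fun h => ⟨by rintro rfl; exact h.elim (hR x) (hR x), h⟩⟩

theorem graphCHom_iff (G : SimpleGraph V) : GraphCHom G ↔ DigraphCHom G.Adj := by
  unfold GraphCHom DigraphCHom
  rw [UG_adj]
  constructor
  · intro h X Y hX hY hc φ hφ
    obtain ⟨ψ, hψ⟩ := h X Y hX hY hc φ hφ
    exact ⟨ψ.toEquiv, fun x y => ψ.map_adj_iff, hψ⟩
  · intro h X Y hX hY hc φ hφ
    obtain ⟨ψ, hψ', hψ⟩ := h X Y hX hY hc φ hφ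
    exact ⟨⟨ψ, fun {x y} => hψ' x y⟩, hψ⟩

theorem _root_.DigraphCHom.tuple (h : DigraphCHom R) {ι : Type*} [Finite ι] {u u' : ι → V}
    (hu : Function.Injective u) (hu' : Function.Injective u')
    (huu : ∀ i j, R (u i) (u j) ↔ R (u' i) (u' j))
    (hc : ((UG R).induce (range u)).Connected) :
    ∃ ψ : Equiv.Perm V, (∀ x y, R (ψ x) (ψ y) ↔ R x y) ∧ ∀ i, ψ (u i) = u' i := by
  let e : range u ≃ range u' := (Equiv.ofInjective u hu).symm.trans (Equiv.ofInjective u' hu')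
  have he : ∀ i, e ⟨u i, mem_range_self i⟩ = ⟨u' i, mem_range_self i⟩ := fun i => by
    simp only [e, Equiv.trans_apply]
    rw [Equiv.ofInjective_symm_apply hu]
    rfl
  obtain ⟨ψ, hψ, hψ'⟩ := h (range u) (range u') (finite_range u) (finite_range u') hc e (by
    rintro ⟨_, i, rfl⟩ ⟨_, j, rfl⟩
    rw [he, he]
    exact huu i j)
  exact ⟨ψ, hψ, fun i => by rw [hψ' ⟨u i, mem_range_self i⟩, he]⟩

theorem connected_range_star {n : ℕ} {u : Fin n → V} {i : Fin n}
    (hi : ∀ j, j ≠ i → G.Adj (u i) (u j)) : (G.induce (range u)).Connected := by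
  refine connected_iff.2 ⟨⟨_, mem_range_self i⟩, joined_star (i := u i) ?_ (mem_range_self i)⟩
  rintro _ ⟨j, rfl⟩
  by_cases h : j = i
  · exact Or.inl (by rw [h])
  · exact Or.inr (hi j h)

theorem IndPath.iso (h : GraphCHom G) {n : ℕ} {p q : ℕ → V} (hp : IndPath G n p)
    (hq : IndPath G n q) : ∃ ψ : G ≃g G, ∀ i ≤ n, ψ (p i) = q i := by
  have inj : ∀ {p : ℕ → V}, IndPath G n p →
      Function.Injective fun i : Fin (n + 1) => p i.1 := by
    intro p hp i j hij
    rcases lt_trichotomy i j with h | h | h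
    · exact absurd hij (hp i j h (by omega)).1
    · exact h
    · exact absurd hij.symm (hp j i h (by omega)).1
  have adj : ∀ {p : ℕ → V}, IndPath G n p → ∀ i j : Fin (n + 1),
      G.Adj (p i) (p j) ↔ i.1 + 1 = j ∨ j.1 + 1 = i := by
    intro p hp i j
    rcases lt_trichotomy i j with h | h | h
    · rw [(hp i j h (by omega)).2]
      omega
    · subst h
      simp
    · rw [G.adj_comm, (hp j i h (by omega)).2]
      omega
  obtain ⟨ψ, hψ, hψ'⟩ := ((graphCHom_iff G).1 h).tuple (inj hp) (inj hq)
    (fun i j => by rw [adj hp, adj hq]) (by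
      rw [UG_adj, connected_iff]
      refine ⟨⟨_, mem_range_self 0⟩, ?_⟩
      have h0 : ∀ x ∈ range (fun i : Fin (n + 1) => p i.1),
          Joined G (range fun i : Fin (n + 1) => p i.1) (p 0) x := by
        rintro _ ⟨i, rfl⟩
        exact .of_fun (Nat.zero_le _) (fun j _ hj => ⟨⟨j, by omega⟩, rfl⟩)
          (fun j _ hj => hp.adj (by omega))
      exact fun x hx y hy => (h0 x hx).symm.trans (h0 y hy))
  exact ⟨⟨ψ, fun {x y} => hψ x y⟩, fun i hi => hψ' ⟨i, by omega⟩⟩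

end Homogeneous

end CHom

namespace CHom

section Necessity

variable {V : Type u} {G : SimpleGraph V}

theorem mem_commonNeighbors {u v w : V} :
    u ∈ G.commonNeighbors v w ↔ G.Adj v u ∧ G.Adj w u := G.mem_commonNeighbors

/-- `u, v, w` is an induced path. -/
def P3 (G : SimpleGraph V) (u v w : V) : Prop :=
  G.Adj u v ∧ G.Adj v w ∧ u ≠ w ∧ ¬ G.Adj u w

theorem P3.mem {u v w : V} (h : P3 G u v w) : v ∈ G.commonNeighbors u w :=
  mem_commonNeighbors.2 ⟨h.1, h.2.1.symm⟩

theorem p3_of_mem {u v w : V} (h : v ∈ G.commonNeighbors u w) (hne : u ≠ w)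
    (hadj : ¬ G.Adj u w) : P3 G u v w :=
  ⟨(mem_commonNeighbors.1 h).1, (mem_commonNeighbors.1 h).2.symm, hne, hadj⟩

theorem star3_iso (hG : GraphCHom G) {a b c a' b' c' : V} (hab : G.Adj a b) (hac : G.Adj a c)
    (hbc : b ≠ c) (hab' : G.Adj a' b') (hac' : G.Adj a' c') (hbc' : b' ≠ c')
    (h : G.Adj b c ↔ G.Adj b' c') : ∃ ψ : G ≃g G, ψ a = a' ∧ ψ b = b' ∧ ψ c = c' := by
  obtain ⟨ψ, hψ, hψ'⟩ := ((graphCHom_iff G).1 hG).tuple (u := ![a, b, c])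
    (u' := ![a', b', c'])
    (by
      intro i j hij
      fin_cases i <;> fin_cases j <;> simp_all [hab.ne, hac.ne, hab.ne', hac.ne', hbc.symm])
    (by
      intro i j hij
      fin_cases i <;> fin_cases j <;> simp_all [hab'.ne, hac'.ne, hab'.ne', hac'.ne', hbc'.symm])
    (by
      intro i j
      fin_cases i <;> fin_cases j <;>
        simp [hab, hac, hab.symm, hac.symm, hab', hac', hab'.symm, hac'.symm, h, G.adj_comm c b,
          G.adj_comm c' b'])
    (by
      rw [UG_adj]
      refine connected_range_star (i := 0) fun j hj => ?_
      fin_cases j <;> simp_all)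
  exact ⟨⟨ψ, fun {x y} => hψ x y⟩, hψ' 0, hψ' 1, hψ' 2⟩

theorem star4_iso (hG : GraphCHom G) {a b c d a' b' c' d' : V} (hab : G.Adj a b)
    (hac : G.Adj a c) (had : G.Adj a d) (hbc : b ≠ c) (hbd : b ≠ d) (hcd : c ≠ d)
    (hab' : G.Adj a' b') (hac' : G.Adj a' c') (had' : G.Adj a' d') (hbc' : b' ≠ c')
    (hbd' : b' ≠ d') (hcd' : c' ≠ d')
    (h : G.Adj b c ↔ G.Adj b' c') (h₁ : G.Adj b d ↔ G.Adj b' d')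
    (h₂ : G.Adj c d ↔ G.Adj c' d') :
    ∃ ψ : G ≃g G, ψ a = a' ∧ ψ b = b' ∧ ψ c = c' ∧ ψ d = d' := by
  obtain ⟨ψ, hψ, hψ'⟩ := ((graphCHom_iff G).1 hG).tuple (u := ![a, b, c, d])
    (u' := ![a', b', c', d'])
    (by
      intro i j hij
      fin_cases i <;> fin_cases j <;> simp_all [hab.ne, hac.ne, hab.ne', hac.ne', had.ne, had.ne',
        hbc.symm, hbd.symm, hcd.symm])
    (by
      intro i j hij
      fin_cases i <;> fin_cases j <;> simp_all [hab'.ne, hac'.ne, hab'.ne', hac'.ne', had'.ne,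
        had'.ne', hbc'.symm, hbd'.symm, hcd'.symm])
    (by
      intro i j
      fin_cases i <;> fin_cases j <;>
        simp [hab, hac, had, hab.symm, hac.symm, had.symm, hab', hac', had', hab'.symm, hac'.symm,
          had'.symm, h, h₁, h₂, G.adj_comm c b, G.adj_comm c' b', G.adj_comm d b,
          G.adj_comm d' b', G.adj_comm d c, G.adj_comm d' c'])
    (by
      rw [UG_adj]
      refine connected_range_star (i := 0) fun j hj => ?_
      fin_cases j <;> simp_all)
  exact ⟨⟨ψ, fun {x y} => hψ x y⟩, hψ' 0, hψ' 1, hψ' 2, hψ' 3⟩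

theorem P3.iso (hG : GraphCHom G) {u v w u' v' w' : V} (h : P3 G u v w) (h' : P3 G u' v' w') :
    ∃ ψ : G ≃g G, ψ u = u' ∧ ψ v = v' ∧ ψ w = w' := by
  obtain ⟨ψ, h1, h2, h3⟩ := star3_iso hG h.1.symm h.2.1 h.2.2.1 h'.1.symm h'.2.1 h'.2.2.1
    (by simp [h.2.2.2, h'.2.2.2])
  exact ⟨ψ, h2, h1, h3⟩

theorem edge_iso (hG : GraphCHom G) {u v u' v' : V} (h : G.Adj u v) (h' : G.Adj u' v') :
    ∃ ψ : G ≃g G, ψ u = u' ∧ ψ v = v' := by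
  obtain ⟨ψ, hψ⟩ := IndPath.iso hG (n := 1) (p := fun i => if i = 0 then u else v)
    (q := fun i => if i = 0 then u' else v')
    (by
      intro i j hij hj
      obtain ⟨rfl, rfl⟩ : i = 0 ∧ j = 1 := by omega
      simp [h, h.ne])
    (by
      intro i j hij hj
      obtain ⟨rfl, rfl⟩ : i = 0 ∧ j = 1 := by omega
      simp [h', h'.ne])
  exact ⟨ψ, by simpa using hψ 0 (by simp), by simpa using hψ 1 le_rfl⟩

theorem vertex_iso (hG : GraphCHom G) (u u' : V) : ∃ ψ : G ≃g G, ψ u = u' := by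
  obtain ⟨ψ, hψ⟩ := IndPath.iso hG (n := 0) (p := fun _ => u) (q := fun _ => u')
    (by
      intro i j hij hj
      omega)
    (by
      intro i j hij hj
      omega)
  exact ⟨ψ, hψ 0 le_rfl⟩

theorem image_commonNeighbors (ψ : G ≃g G) (u v : V) :
    ψ '' G.commonNeighbors u v = G.commonNeighbors (ψ u) (ψ v) := by
  ext w
  constructor
  · rintro ⟨w, hw, rfl⟩
    rw [mem_commonNeighbors] at hw ⊢
    exact ⟨ψ.map_adj_iff.2 hw.1, ψ.map_adj_iff.2 hw.2⟩
  · intro hw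
    refine ⟨ψ.symm w, ?_, by simp⟩
    rw [mem_commonNeighbors] at hw ⊢
    rw [← ψ.map_adj_iff, ← ψ.map_adj_iff (v := v)]
    simpa using hw

theorem image_neighborSet (ψ : G ≃g G) (u : V) :
    ψ '' G.neighborSet u = G.neighborSet (ψ u) := by
  ext w
  constructor
  · rintro ⟨w, hw, rfl⟩
    exact ψ.map_adj_iff.2 hw
  · intro hw
    refine ⟨ψ.symm w, ?_, by simp⟩
    rw [SimpleGraph.mem_neighborSet, ← ψ.map_adj_iff]
    simpa using hw

/-- Some finite vertex set separates two of its neighbours that have a common neighbour in it. -/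
def FinSep (G : SimpleGraph V) : Prop :=
  ∃ S : Finset V, ∃ x ∈ S, ∃ c c' : V, c ∉ S ∧ c' ∉ S ∧ G.Adj x c ∧ G.Adj x c' ∧
    ¬ Joined G {v | v ∉ S} c c'

theorem finSep_of_not_joined (hc : G.Connected)
    (h : ∃ (S : Finset V) (a b : V), a ∉ S ∧ b ∉ S ∧ ¬ Joined G {v | v ∉ S} a b) :
    FinSep G := by
  classical
  have h' : ∃ n, ∃ (S : Finset V) (a b : V), S.card = n ∧ a ∉ S ∧ b ∉ S ∧
      ¬ Joined G {v | v ∉ S} a b := by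
    obtain ⟨S, a, b, h⟩ := h
    exact ⟨_, S, a, b, rfl, h⟩
  obtain ⟨S, a, b, hS, ha, hb, hab⟩ := Nat.find_spec h'
  have hmin : ∀ x ∈ S, Joined G {v | v ∉ S.erase x} a b := by
    intro x hx
    by_contra hcon
    refine Nat.find_min h' (m := (S.erase x).card) ?_ ⟨_, a, b, rfl, ?_, ?_, hcon⟩
    · rw [← hS]
      exact Finset.card_erase_lt_of_mem hx
    · exact fun h => ha (Finset.mem_of_mem_erase h)
    · exact fun h => hb (Finset.mem_of_mem_erase h)
  have hne : S.Nonempty := by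
    by_contra hcon
    rw [Finset.not_nonempty_iff_eq_empty] at hcon
    subst hcon
    exact hab ((joined_univ hc a b).mono (by simp))
  obtain ⟨x, hx⟩ := hne
  have key : ∀ a b, a ∉ S → Joined G {v | v ∉ S.erase x} a b → ¬ Joined G {v | v ∉ S} a b →
      ∃ c, Joined G {v | v ∉ S} a c ∧ G.Adj x c := by
    intro a b ha h1 h2
    by_contra! hcon
    refine h2 (h1.induct (P := fun v => Joined G {v | v ∉ S} a v) (.refl ha) ?_)
    intro u v _ hv huv hu
    have hvx : v ≠ x := by
      rintro rfl
      exact hcon u hu huv.symm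
    exact hu.trans (.of_adj hu.right_mem (fun h => hv (Finset.mem_erase.2 ⟨hvx, h⟩)) huv)
  obtain ⟨c, hac, hxc⟩ := key a b ha (hmin x hx) hab
  obtain ⟨c', hbc, hxc'⟩ := key b a hb (hmin x hx).symm (fun h => hab h.symm)
  exact ⟨S, x, hx, c, c', hac.right_mem, hbc.right_mem, hxc, hxc',
    fun h => hab ((hac.trans h).trans hbc.symm)⟩

theorem ray_tail {r : ℕ → V} (hr : IsRay G r) (S : Finset V) : ∃ N, ∀ n, N ≤ n → r n ∉ S := by
  have hfin : {n | r n ∈ S}.Finite := Set.Finite.preimage hr.1.injOn S.finite_toSet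
  obtain ⟨N, hN⟩ := hfin.bddAbove
  exact ⟨N + 1, fun n hn h => by have := hN h; omega⟩

theorem exists_not_joined_of_ends (h : MoreThanOneEnd G) :
    ∃ (S : Finset V) (a b : V), a ∉ S ∧ b ∉ S ∧ ¬ Joined G {v | v ∉ S} a b := by
  obtain ⟨r, r', hr, hr', hne⟩ := h
  unfold RayEquiv at hne
  push Not at hne
  obtain ⟨S, hS⟩ := hne
  obtain ⟨N, hN⟩ := ray_tail hr S
  obtain ⟨N', hN'⟩ := ray_tail hr' S
  refine ⟨S, r N, r' N', hN N le_rfl, hN' N' le_rfl, fun hj => ?_⟩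
  have tail : ∀ {r : ℕ → V} {N : ℕ}, IsRay G r → (∀ n, N ≤ n → r n ∉ S) → ∀ n, N ≤ n →
      Joined G {v | v ∉ S} (r N) (r n) := fun hr hN n hn =>
    .of_fun hn (fun i hi _ => hN i hi) (fun i _ _ => hr.2 i)
  refine hS {v | Joined G {v | v ∉ S} (r N) v} ⟨⟨r N, .refl (hN N le_rfl)⟩,
    fun v hv => hv.right_mem, ?_, ?_⟩ ⟨N, tail hr hN⟩
    ⟨N', fun n hn => hj.trans (tail hr' hN' n hn)⟩
  · exact connected_iff.2 ⟨⟨r N, .refl (hN N le_rfl)⟩,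
      fun x hx y hy => hx.inside.symm.trans hy.inside⟩
  · intro C hC hCS hcon
    refine Subset.antisymm (fun v hv => ?_) hC
    exact ((connected_iff.1 hcon).2 _ (hC (.refl (hN N le_rfl))) v hv).mono hCS

theorem infinite_of_ends (h : MoreThanOneEnd G) : Infinite V := by
  obtain ⟨r, -, hr, -⟩ := h
  exact Infinite.of_injective r hr.1

theorem finite_commonNeighbors (hG : GraphCHom G) (hS : FinSep G) {u v : V} (hne : u ≠ v)
    (huv : ¬ G.Adj u v) : (G.commonNeighbors u v).Finite := by
  rcases (G.commonNeighbors u v).eq_empty_or_nonempty with h | ⟨w, hw⟩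
  · rw [h]
    exact finite_empty
  obtain ⟨S, x, hx, c, c', hcS, hcS', hxc, hxc', hcc⟩ := hS
  have h3 : P3 G c x c' := by
    refine ⟨hxc.symm, hxc', ?_, fun h => hcc (.of_adj hcS hcS' h)⟩
    rintro rfl
    exact hcc (.refl hcS)
  obtain ⟨ψ, rfl, -, rfl⟩ := h3.iso hG (p3_of_mem hw hne huv)
  rw [← image_commonNeighbors]
  refine Set.Finite.image _ (S.finite_toSet.subset fun s hs => ?_)
  by_contra hsS
  rw [mem_commonNeighbors] at hs
  exact hcc ((Joined.of_adj hcS hsS hs.1).trans (.of_adj hsS hcS' hs.2.symm))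

theorem ncard_commonNeighbors (hG : GraphCHom G) {u v w u' v' w' : V} (h : P3 G u v w)
    (h' : P3 G u' v' w') :
    (G.commonNeighbors u w).ncard = (G.commonNeighbors u' w').ncard := by
  obtain ⟨ψ, rfl, -, rfl⟩ := h.iso hG h'
  rw [← image_commonNeighbors, Set.ncard_image_of_injective _ ψ.injective]

/-- No vertex closes an induced path of length `k` to an induced cycle. -/
def NoCyc (G : SimpleGraph V) (k : ℕ) : Prop :=
  ∀ p : ℕ → V, IndPath G k p → ∀ w, G.Adj w (p 0) → G.Adj w (p k) →
    (∀ i, 0 < i → i < k → w ≠ p i ∧ ¬ G.Adj w (p i)) → False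

/-- There are no induced cycles of length four. -/
def NoSquare (G : SimpleGraph V) : Prop :=
  ∀ p q r s : V, P3 G p q r → s ∈ G.commonNeighbors p r → s ≠ q → G.Adj s q

/-- Two nonadjacent vertices have at most one common neighbour. -/
def UniqueCommon (G : SimpleGraph V) : Prop :=
  ∀ u v w w' : V, P3 G u w v → P3 G u w' v → w = w'

theorem indPath_two {a b c : V} (h : P3 G a b c) :
    IndPath G 2 (fun i => if i = 0 then a else if i = 1 then b else c) := by
  obtain ⟨h1, h2, h3, h4⟩ := h
  intro i j hij hj
  interval_cases j <;> interval_cases i <;> simp [*, h1.ne, h2.ne]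

theorem indPath_three {a b c d : V} (h : P3 G a b c) (hcd : G.Adj c d) (had : ¬ G.Adj a d)
    (hbd : ¬ G.Adj b d) :
    IndPath G 3 (fun i => if i = 0 then a else if i = 1 then b else if i = 2 then c else d) := by
  obtain ⟨h1, h2, h3, h4⟩ := h
  have e1 : a ≠ d := by
    rintro rfl
    exact h4 hcd.symm
  have e2 : b ≠ d := by
    rintro rfl
    exact had h1
  intro i j hij hj
  interval_cases j <;> interval_cases i <;> simp [*, h1.ne, h2.ne, hcd.ne]

theorem indPath_four {a b c d e : V} (h : P3 G a b c) (hcd : G.Adj c d) (had : ¬ G.Adj a d)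
    (hbd : ¬ G.Adj b d) (hde : G.Adj d e) (hae : ¬ G.Adj a e) (hbe : ¬ G.Adj b e)
    (hce : ¬ G.Adj c e) :
    IndPath G 4 (fun i => if i = 0 then a else if i = 1 then b else if i = 2 then c
      else if i = 3 then d else e) := by
  obtain ⟨h1, h2, h3, h4⟩ := h
  have e1 : a ≠ d := by
    rintro rfl
    exact h4 hcd.symm
  have e2 : b ≠ d := by
    rintro rfl
    exact had h1
  have e3 : a ≠ e := by
    rintro rfl
    exact had hde.symm
  have e4 : b ≠ e := by
    rintro rfl
    exact hae h1
  have e5 : c ≠ e := by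
    rintro rfl
    exact hbe h2
  intro i j hij hj
  interval_cases j <;> interval_cases i <;> simp [*, h1.ne, h2.ne, hcd.ne, hde.ne]

theorem NoCyc.noSquare (h : NoCyc G 2) : NoSquare G := by
  intro p q r s h3 hs hsq
  by_contra hadj
  rw [mem_commonNeighbors] at hs
  refine h _ (indPath_two h3) s (by simpa using hs.1.symm) (by simpa using hs.2.symm) ?_
  intro i h0 h2
  obtain rfl : i = 1 := by omega
  simp [hsq, hadj]

theorem eq_of_commonNeighbors_eq (hG : GraphCHom G) (hsq : NoSquare G) {x c y₁ y₂ p : V}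
    (hxc : G.Adj x c) (hx₁ : G.Adj x y₁) (hx₂ : G.Adj x y₂) (hy : y₁ ≠ y₂) (hc₁ : c ≠ y₁)
    (hc₂ : c ≠ y₂) (hn₁ : ¬ G.Adj c y₁) (hn₂ : ¬ G.Adj c y₂)
    (hP : G.commonNeighbors c y₁ = G.commonNeighbors c y₂) (hp : p ∈ G.commonNeighbors c y₁) :
    p = x := by
  by_contra hpx
  have hadj : G.Adj p x := hsq c x y₁ p ⟨hxc.symm, hx₁, hc₁, hn₁⟩ hp hpx
  have hp' := mem_commonNeighbors.1 hp
  have hn₁' : ¬ G.Adj y₁ c := fun h => hn₁ h.symm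
  have hn₂' : ¬ G.Adj y₂ c := fun h => hn₂ h.symm
  have key : ∀ w, G.Adj x w → G.Adj c w → w ≠ p → G.Adj w p := by
    intro w hxw hcw hwp
    by_cases hw : w ∈ G.commonNeighbors c y₁
    · exact hsq c p y₁ w (p3_of_mem hp hc₁ hn₁) hw hwp
    have hw₁ : ¬ G.Adj y₁ w := fun h => hw (mem_commonNeighbors.2 ⟨hcw, h⟩)
    have hw₂ : ¬ G.Adj y₂ w := fun h => hw (hP ▸ mem_commonNeighbors.2 ⟨hcw, h⟩)
    have hw₂' : ¬ G.Adj w y₂ := fun h => hw₂ h.symm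
    have e₁ : y₁ ≠ w := by
      rintro rfl
      exact hn₁ hcw
    have e₂ : y₂ ≠ w := by
      rintro rfl
      exact hn₂ hcw
    have hpM : p ∈ G.commonNeighbors y₁ w := by
      by_cases h12 : G.Adj y₁ y₂
      · obtain ⟨ψ, -, h1, h2, h3⟩ := star4_iso hG (a := x) (b := c) (c := y₁) (d := y₂)
          (a' := x) (b' := y₁) (c' := c) (d' := w) hxc hx₁ hx₂ hc₁ hc₂ hy hx₁ hxc hxw hc₁.symm
          e₁ hcw.ne (by simp [hn₁, hn₁']) (by simp [hn₂, hw₁]) (by simp [h12, hcw])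
        have := congrArg (fun s => ψ '' s) hP
        simp only [image_commonNeighbors, h1, h2, h3] at this
        rw [← this, SimpleGraph.commonNeighbors_symm]
        exact hp
      · obtain ⟨ψ, -, h1, h2, h3⟩ := star4_iso hG (a := x) (b := c) (c := y₁) (d := y₂)
          (a' := x) (b' := y₁) (c' := c) (d' := y₂) hxc hx₁ hx₂ hc₁ hc₂ hy hx₁ hxc hx₂ hc₁.symm
          hy hc₂ (by simp [hn₁, hn₁']) (by simp [hn₂, h12]) (by simp [h12, hn₂])
        obtain ⟨ψ', -, h1', h2', h3'⟩ := star4_iso hG (a := x) (b := c) (c := y₁) (d := y₂)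
          (a' := x) (b' := y₁) (c' := w) (d' := y₂) hxc hx₁ hx₂ hc₁ hc₂ hy hx₁ hxw hx₂ e₁
          hy e₂.symm (by simp [hn₁, hw₁]) (by simp [hn₂, h12]) (by simp [h12, hw₂'])
        have := congrArg (fun s => ψ '' s) hP
        have this' := congrArg (fun s => ψ' '' s) hP
        simp only [image_commonNeighbors, h1, h2, h3] at this
        simp only [image_commonNeighbors, h1', h2', h3'] at this'
        rw [this', ← this, SimpleGraph.commonNeighbors_symm]
        exact hp
    exact (mem_commonNeighbors.1 hpM).2
  obtain ⟨ψ, hψx, hψc, hψp⟩ := star3_iso hG (a := x) (b := c) (c := p) (a' := x) (b' := p)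
    (c' := c) hxc hadj.symm hp'.1.ne hadj.symm hxc hp'.1.ne' (G.adj_comm _ _)
  have h1 : G.Adj x (ψ.symm y₁) := by
    rw [← ψ.map_adj_iff, hψx]
    simpa using hx₁
  have h2 : G.Adj c (ψ.symm y₁) := by
    rw [← ψ.map_adj_iff, hψc]
    simpa using hp'.2.symm
  have hne : ψ.symm y₁ ≠ p := by
    intro h
    refine hc₁ ?_
    rw [← hψp, ← h]
    simp
  have h3 := key _ h1 h2 hne
  rw [← ψ.map_adj_iff, hψp] at h3
  exact hn₁' (by simpa using h3)

theorem uniqueCommon_of (hG : GraphCHom G) {u v w : V} (h : P3 G u v w)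
    (hu : ∀ p ∈ G.commonNeighbors u w, p = v) : UniqueCommon G := by
  have h1 : (G.commonNeighbors u w).ncard = 1 := by
    rw [Set.ncard_eq_one]
    exact ⟨v, Subset.antisymm hu (by simpa using h.mem)⟩
  intro a b c c' hc hc'
  rw [ncard_commonNeighbors hG h hc, Set.ncard_eq_one] at h1
  obtain ⟨e, he⟩ := h1
  have := he ▸ hc.mem
  have := he ▸ hc'.mem
  simp_all

end Necessity

end CHom

namespace CHom

section LocallyFinite

variable {V : Type u} {G : SimpleGraph V}

theorem finite_jl (hfin : ∀ v, (G.neighborSet v).Finite) (n : ℕ) :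
    ∀ x, {y | JL G univ n x y}.Finite := by
  induction n with
  | zero =>
    intro x
    refine (finite_singleton x).subset fun y hy => ?_
    exact (JL.eq_of_zero hy).symm
  | succ n ih =>
    intro x
    refine ((hfin x).biUnion fun y _ => ih y).subset fun z hz => ?_
    cases hz with
    | @cons _ _ y _ _ hxy h => exact mem_iUnion₂.2 ⟨y, hxy, h⟩

theorem exists_geodesic [Infinite V] (hc : G.Connected) (hfin : ∀ v, (G.neighborSet v).Finite)
    (n : ℕ) : ∃ p, IndPath G n p ∧ ∀ m, JL G univ m (p 0) (p n) → n ≤ m := by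
  obtain ⟨x⟩ := hc.nonempty
  have hball : (⋃ m ∈ Iic n, {y | JL G univ m x y}).Finite :=
    (finite_Iic n).biUnion fun m _ => finite_jl hfin m x
  obtain ⟨y, hy⟩ := hball.exists_notMem
  obtain ⟨N, p, rfl, rfl, -, hp, hmin⟩ := exists_indPath (joined_univ hc x y)
  have hpath : ∀ i j, i ≤ j → j ≤ N → JL G univ (j - i) (p i) (p j) := fun i j hij hj =>
    .of_fun hij (fun _ _ _ => mem_univ _) (fun k _ hk => hp.adj (by omega))
  have hN : n < N := by
    by_contra hcon
    refine hy (mem_iUnion₂.2 ⟨N, not_lt.1 hcon, ?_⟩)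
    simpa using hpath 0 N (Nat.zero_le _) le_rfl
  refine ⟨p, hp.mono hN.le, fun m hm => ?_⟩
  have := hmin _ (hm.trans (hpath n N hN.le le_rfl))
  omega

theorem JL.map {A B : Set V} (ψ : G ≃g G) {n : ℕ} {x y : V} (h : JL G A n x y)
    (hAB : ∀ a ∈ A, ψ a ∈ B) : JL G B n (ψ x) (ψ y) := by
  induction h with
  | refl hx => exact .refl (hAB _ hx)
  | cons hx hxy _ ih => exact .cons (hAB _ hx) (ψ.map_adj_iff.2 hxy) ih

theorem IndPath.le_of_jl [Infinite V] (hG : GraphCHom G) (hc : G.Connected)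
    (hfin : ∀ v, (G.neighborSet v).Finite) {n : ℕ} {p : ℕ → V} (hp : IndPath G n p) {m : ℕ}
    (hm : JL G univ m (p 0) (p n)) : n ≤ m := by
  obtain ⟨q, hq, hmin⟩ := exists_geodesic hc hfin n
  obtain ⟨ψ, hψ⟩ := hp.iso hG hq
  refine hmin m ?_
  rw [← hψ 0 (Nat.zero_le n), ← hψ n le_rfl]
  exact hm.map ψ fun _ _ => mem_univ _

theorem P3.extend [Infinite V] (hG : GraphCHom G) (hc : G.Connected)
    (hfin : ∀ v, (G.neighborSet v).Finite) {a b c : V} (h : P3 G a b c) :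
    ∃ d, G.Adj c d ∧ ¬ G.Adj b d ∧ ¬ G.Adj a d := by
  obtain ⟨q, hq, -⟩ := exists_geodesic hc hfin 3
  obtain ⟨ψ, hψ⟩ := (hq.mono (show 2 ≤ 3 by omega)).iso hG (indPath_two h)
  have h0 : ψ (q 0) = a := by simpa using hψ 0 (by omega)
  have h1 : ψ (q 1) = b := by simpa using hψ 1 (by omega)
  have h2 : ψ (q 2) = c := by simpa using hψ 2 (by omega)
  refine ⟨ψ (q 3), ?_, ?_, ?_⟩
  · rw [← h2, ψ.map_adj_iff]
    exact hq.adj (by omega)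
  · rw [← h1, ψ.map_adj_iff, (hq 1 3 (by omega) le_rfl).2]
    omega
  · rw [← h0, ψ.map_adj_iff, (hq 0 3 (by omega) le_rfl).2]
    omega

theorem IndPath.no_common [Infinite V] (hG : GraphCHom G) (hc : G.Connected)
    (hfin : ∀ v, (G.neighborSet v).Finite) {n : ℕ} {p : ℕ → V} (hp : IndPath G n p)
    (hn : 3 ≤ n) {w : V} (h0 : G.Adj (p 0) w) (h1 : G.Adj w (p n)) : False := by
  have := hp.le_of_jl hG hc hfin
    ((JL.single (mem_univ _) (mem_univ _) h0).trans (.single (mem_univ _) (mem_univ _) h1))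
  omega

theorem noCyc_of_finite [Infinite V] (hG : GraphCHom G) (hc : G.Connected)
    (hfin : ∀ v, (G.neighborSet v).Finite) {k : ℕ} (hk : 3 ≤ k) : NoCyc G k :=
  fun _ hp _ h0 h1 _ => hp.no_common hG hc hfin hk h0.symm h1

theorem noSquare_of_finite [Infinite V] (hG : GraphCHom G) (hc : G.Connected)
    (hfin : ∀ v, (G.neighborSet v).Finite) : NoSquare G := by
  intro p q r s h3 hs hsq
  by_contra hadj
  rw [mem_commonNeighbors] at hs
  have hsrq : P3 G s r q := ⟨hs.2.symm, h3.2.1.symm, hsq, hadj⟩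
  obtain ⟨e, hqe, hre, hse⟩ := hsrq.extend hG hc hfin
  have hpath := indPath_three hsrq hqe hse hre
  have hse' : ∀ w, G.Adj s w → ¬ G.Adj w e := fun w h h' =>
    hpath.no_common hG hc hfin le_rfl (w := w) (by simpa using h) (by simpa using h')
  have hpe : ¬ G.Adj p e := hse' p hs.1.symm
  have hep : P3 G e q p := ⟨hqe.symm, h3.1.symm, by
    rintro rfl
    exact hse hs.1.symm, fun h => hpe h.symm⟩
  let F : V → V → V → Set V := fun u v w => {f | f ∈ G.commonNeighbors u w ∧ f ≠ v ∧ ¬ G.Adj f v}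
  have hsub : F e q p ⊆ F p q r := by
    rintro f ⟨hf, hfq, hfq'⟩
    rw [mem_commonNeighbors] at hf
    refine ⟨mem_commonNeighbors.2 ⟨hf.2, ?_⟩, hfq, hfq'⟩
    by_contra hfr
    have hfs : ¬ G.Adj f s := fun h => hse' f h.symm hf.1.symm
    have hefp : P3 G e f p := ⟨hf.1, hf.2.symm, hep.2.2.1, hep.2.2.2⟩
    have := indPath_four hefp hs.1 (fun h => hse h.symm) hfs hs.2.symm (fun h => hre h.symm)
      (fun h => hfr h.symm) h3.2.2.2
    exact this.no_common hG hc hfin (by omega) (w := q) (by simpa using hqe.symm)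
      (by simpa using h3.2.1)
  obtain ⟨ψ, h1, h2, h3'⟩ := h3.iso hG hep
  have himage : ∀ u v w, F (ψ u) (ψ v) (ψ w) = ψ '' F u v w := by
    intro u v w
    ext f
    constructor
    · rintro ⟨hf, hfq, hfq'⟩
      rw [← image_commonNeighbors] at hf
      obtain ⟨f, hf, rfl⟩ := hf
      exact ⟨f, ⟨hf, fun h => hfq (h ▸ rfl), fun h => hfq' (ψ.map_adj_iff.2 h)⟩, rfl⟩
    · rintro ⟨f, ⟨hf, hfq, hfq'⟩, rfl⟩
      refine ⟨?_, fun h => hfq (ψ.injective h), fun h => hfq' (ψ.map_adj_iff.1 h)⟩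
      rw [← image_commonNeighbors]
      exact mem_image_of_mem _ hf
  have hcard := himage p q r
  rw [h1, h2, h3'] at hcard
  have hFfin : (F p q r).Finite :=
    (hfin p).subset fun f hf => (mem_commonNeighbors.1 hf.1).1
  have heq : F e q p = F p q r := by
    refine Set.eq_of_subset_of_ncard_le hsub ?_ hFfin
    rw [hcard, Set.ncard_image_of_injective _ ψ.injective]
  have hsF : s ∈ F e q p := heq ▸ ⟨mem_commonNeighbors.2 hs, hsq, hadj⟩
  exact hse (mem_commonNeighbors.1 hsF.1).1.symm

theorem uniqueCommon_of_finite [Infinite V] (hG : GraphCHom G) (hc : G.Connected)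
    (hfin : ∀ v, (G.neighborSet v).Finite) : UniqueCommon G := by
  intro u v w w' hw hw'
  by_contra hne
  refine hne ?_
  have hsq := noSquare_of_finite hG hc hfin
  obtain ⟨e, hve, hwe, hue⟩ := hw.extend hG hc hfin
  have hpath := indPath_three hw hve hue hwe
  have hue' : ∀ f, G.Adj u f → ¬ G.Adj f e := fun f h h' =>
    hpath.no_common hG hc hfin le_rfl (w := f) (by simpa using h) (by simpa using h')
  have hwve : P3 G w v e := ⟨hw.2.1, hve, by
    rintro rfl
    exact hue hw.1, hwe⟩
  obtain ⟨ψ, h1, h2, h3⟩ := hw.iso hG hwve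
  -- a second common neighbour of `w` and `e`
  obtain ⟨f, hf, hfv⟩ : ∃ f, f ∈ G.commonNeighbors w e ∧ f ≠ v := by
    refine ⟨ψ w', ?_, fun h => hne ?_⟩
    · rw [← h1, ← h3, ← image_commonNeighbors]
      exact mem_image_of_mem _ hw'.mem
    · exact ψ.injective (h2.trans h.symm)
  have hfv' : G.Adj f v := hsq _ _ _ _ hwve hf hfv
  rw [mem_commonNeighbors] at hf
  have huf : ¬ G.Adj u f := fun h => hue' f h hf.2.symm
  have huwf : P3 G u w f := ⟨hw.1, hf.1, by
    rintro rfl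
    exact hue hf.2.symm, huf⟩
  have hsub : G.commonNeighbors u v ⊆ G.commonNeighbors u f := by
    intro s hs
    by_cases hsw : s = w
    · rw [hsw]
      exact huwf.mem
    have hsw' : G.Adj s w := hsq _ _ _ _ hw hs hsw
    rw [mem_commonNeighbors] at hs ⊢
    refine ⟨hs.1, ?_⟩
    by_contra hsf
    have hswf : P3 G s w f := ⟨hsw', hf.1, by
      rintro rfl
      exact huf hs.1, fun h => hsf h.symm⟩
    exact (indPath_three hswf hf.2.symm (hue' s hs.1) hwe).no_common hG hc hfin le_rfl
      (w := v) (by simpa using hs.2.symm) (by simpa using hve)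
  have hMfin : (G.commonNeighbors u f).Finite :=
    (hfin u).subset fun s hs => (mem_commonNeighbors.1 hs).1
  have heq : G.commonNeighbors u v = G.commonNeighbors u f :=
    Set.eq_of_subset_of_ncard_le hsub (ncard_commonNeighbors hG huwf hw).le hMfin
  refine (eq_of_commonNeighbors_eq hG hsq hw.1.symm hw.2.1 hf.1 hfv.symm hw.2.2.1 huwf.2.2.1
    hw.2.2.2 huf heq hw'.mem).symm

end LocallyFinite

section InfiniteDegree

variable {V : Type u} {G : SimpleGraph V}

theorem exists_star_of_infinite (hS : FinSep G) (hinf : ∀ v, (G.neighborSet v).Infinite) :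
    ∃ S : Finset V, ∃ x ∈ S, ∃ c, c ∉ S ∧ G.Adj x c ∧
      ∃ Y : Set V, Y.Infinite ∧ ∀ y ∈ Y, G.Adj x y ∧ y ∉ S ∧ ¬ Joined G {v | v ∉ S} c y := by
  obtain ⟨S, x, hx, c, c', hcS, hcS', hxc, hxc', hcc⟩ := hS
  have hN : (G.neighborSet x \ S).Infinite := (hinf x).sdiff S.finite_toSet
  by_cases h : {y ∈ G.neighborSet x \ S | ¬ Joined G {v | v ∉ S} c y}.Infinite
  · exact ⟨S, x, hx, c, hcS, hxc, _, h, fun y hy => ⟨hy.1.1, hy.1.2, hy.2⟩⟩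
  · rw [Set.not_infinite] at h
    refine ⟨S, x, hx, c', hcS', hxc', _, hN.sdiff h, fun y hy => ⟨hy.1.1, hy.1.2, fun h' => ?_⟩⟩
    have : Joined G {v | v ∉ S} c y := by
      by_contra hcon
      exact hy.2 ⟨hy.1, hcon⟩
    exact hcc (this.trans h'.symm)

theorem infinite_neighbors_diff (hG : GraphCHom G) (hS : FinSep G)
    (hinf : ∀ v, (G.neighborSet v).Infinite) {u v : V} (huv : G.Adj u v) :
    {w ∈ G.neighborSet v | w ≠ u ∧ ¬ G.Adj u w}.Infinite := by
  have key : ∀ {u v u' v' : V}, G.Adj u v → G.Adj u' v' →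
      {w ∈ G.neighborSet v | w ≠ u ∧ ¬ G.Adj u w}.Finite →
      {w ∈ G.neighborSet v' | w ≠ u' ∧ ¬ G.Adj u' w}.Finite := by
    intro u v u' v' h h' hf
    obtain ⟨ψ, rfl, rfl⟩ := edge_iso hG h h'
    refine (hf.image ψ).subset ?_
    rintro w ⟨h1, h2, h3⟩
    rw [← image_neighborSet] at h1
    obtain ⟨w, h1, rfl⟩ := h1
    exact ⟨w, ⟨h1, fun h => h2 (h ▸ rfl), fun h => h3 (ψ.map_adj_iff.2 h)⟩, rfl⟩
  intro hfin
  have hfc := fun {u v : V} => finite_commonNeighbors hG hS (u := u) (v := v)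
  obtain ⟨S, x, hx, c, c', hcS, hcS', hxc, hxc', hcc⟩ := hS
  have hne : c ≠ c' := by
    rintro rfl
    exact hcc (.refl hcS)
  have hnadj : ¬ G.Adj c c' := fun h => hcc (.of_adj hcS hcS' h)
  have h1 := key huv hxc.symm hfin
  have h2 := key huv hxc'.symm hfin
  refine hinf x ((((h1.union h2).union (hfc hne hnadj)).union ((finite_singleton c).union
    (finite_singleton c'))).subset fun w hw => ?_)
  have hw' : G.Adj x w := hw
  simp only [mem_union, mem_ofPred_eq, mem_singleton_iff, mem_commonNeighbors,
    SimpleGraph.mem_neighborSet]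
  tauto

/-- The path obtained by appending a vertex after `p 0, …, p n`. -/
def extendPath (p : ℕ → V) (n : ℕ) (z : V) : ℕ → V := fun i => if i ≤ n then p i else z

theorem IndPath.extendPath {n : ℕ} {p : ℕ → V} (h : IndPath G n p) {z : V}
    (hz : G.Adj (p n) z) (hne : ∀ i < n, p i ≠ z ∧ ¬ G.Adj (p i) z) :
    IndPath G (n + 1) (extendPath p n z) := by
  intro i j hij hj
  unfold CHom.extendPath
  rw [if_pos (show i ≤ n by omega)]
  split_ifs with hjn
  · exact h i j hij hjn
  · obtain rfl : j = n + 1 := by omega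
    rcases (show i ≤ n by omega).lt_or_eq with hi | rfl
    · exact ⟨(hne i hi).1, iff_of_false (hne i hi).2 (by omega)⟩
    · exact ⟨hz.ne, iff_of_true hz rfl⟩

theorem exists_long_paths (hG : GraphCHom G) (hS : FinSep G)
    (hinf : ∀ v, (G.neighborSet v).Infinite) :
    ∃ (S : Finset V) (c : V), c ∉ S ∧ ∀ l, 1 ≤ l → ∃ p, IndPath G l p ∧ p 0 = c ∧
      ∃ Z : Set V, Z.Infinite ∧ ∀ z ∈ Z, G.Adj (p l) z ∧
        (∀ i < l, p i ≠ z ∧ ¬ G.Adj (p i) z) ∧ z ∉ S ∧ ¬ Joined G {v | v ∉ S} c z := by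
  have hfc := fun {u v : V} => finite_commonNeighbors hG hS (u := u) (v := v)
  have hdiff := fun {u v : V} => infinite_neighbors_diff hG hS hinf (u := u) (v := v)
  obtain ⟨S, x, hx, c, hcS, hxc, Y, hY, hYp⟩ := exists_star_of_infinite hS hinf
  refine ⟨S, c, hcS, fun l hl => ?_⟩
  induction l, hl using Nat.le_induction with
  | base =>
    refine ⟨fun i => if i = 0 then c else x, ?_, by simp, Y, hY, fun y hy => ?_⟩
    · intro i j hij hj
      obtain ⟨rfl, rfl⟩ : i = 0 ∧ j = 1 := by omega
      simp [hxc.symm, hxc.ne']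
    · obtain ⟨h1, h2, h3⟩ := hYp y hy
      refine ⟨by simpa using h1, fun i hi => ?_, h2, h3⟩
      obtain rfl : i = 0 := by omega
      simp only [if_true]
      refine ⟨?_, fun h => h3 (.of_adj hcS h2 h)⟩
      rintro rfl
      exact h3 (.refl hcS)
  | succ l hl ih =>
    obtain ⟨p, hp, hp0, Z, hZ, hZp⟩ := ih
    obtain ⟨z, hz⟩ := hZ.nonempty
    obtain ⟨h1, h2, h3, h4⟩ := hZp z hz
    have hbad : ((⋃ i ∈ Iio l, G.commonNeighbors z (p i)) ∪ S).Finite :=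
      ((finite_Iio l).biUnion fun i hi => hfc (h2 i hi).1.symm
        (fun h => (h2 i hi).2 h.symm)).union S.finite_toSet
    refine ⟨extendPath p l z, hp.extendPath h1 h2, by simp [extendPath, hp0], _,
      (hdiff h1).sdiff hbad, ?_⟩
    rintro w ⟨⟨hw1, hw2, hw3⟩, hw4⟩
    have hw1' : G.Adj z w := hw1
    have hwS : w ∉ S := fun h => hw4 (Or.inr h)
    refine ⟨by simpa [extendPath] using hw1', fun i hi => ?_, hwS,
      fun h => h4 (h.trans (.of_adj hwS h3 hw1'.symm))⟩
    simp only [extendPath, if_pos (show i ≤ l by omega)]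
    rcases (show i ≤ l by omega).lt_or_eq with hi | rfl
    · refine ⟨?_, fun h => hw4 (Or.inl (mem_iUnion₂.2 ⟨i, hi, mem_commonNeighbors.2 ⟨hw1, h⟩⟩))⟩
      rintro rfl
      exact (h2 i hi).2 hw1'.symm
    · exact ⟨hw2.symm, hw3⟩

theorem noCyc_of_infinite (hG : GraphCHom G) (hS : FinSep G)
    (hinf : ∀ v, (G.neighborSet v).Infinite) {k : ℕ} (hk : 2 ≤ k) : NoCyc G k := by
  intro q hq w hw0 hwk hw
  have hfc := fun {u v : V} => finite_commonNeighbors hG hS (u := u) (v := v)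
  obtain ⟨S, c, hcS, hlong⟩ := exists_long_paths hG hS hinf
  obtain ⟨l, rfl⟩ : ∃ l, k = l + 1 := ⟨k - 1, by omega⟩
  obtain ⟨p, hp, hp0, Z, hZ, hZp⟩ := hlong l (by omega)
  have hclose : ∀ z ∈ Z, ∃ s ∈ S, G.Adj s z ∧ s ≠ p l ∧ ¬ G.Adj s (p l) := by
    intro z hz
    obtain ⟨h1, h2, h3, h4⟩ := hZp z hz
    obtain ⟨ψ, hψ⟩ := hq.iso hG (hp.extendPath h1 h2)
    have e0 : ψ (q 0) = c := by simpa [extendPath, hp0] using hψ 0 (by omega)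
    have el : ψ (q l) = p l := by simpa [extendPath] using hψ l (by omega)
    have ek : ψ (q (l + 1)) = z := by simpa [extendPath] using hψ (l + 1) (by omega)
    have a1 : G.Adj (ψ w) c := e0 ▸ ψ.map_adj_iff.2 hw0
    have a2 : G.Adj (ψ w) z := ek ▸ ψ.map_adj_iff.2 hwk
    refine ⟨ψ w, ?_, a2, ?_, ?_⟩
    · by_contra hcon
      exact h4 ((Joined.of_adj hcS hcon a1.symm).trans (.of_adj hcon h3 a2))
    · rw [← el]
      exact fun h => (hw l (by omega) (by omega)).1 (ψ.injective h)
    · rw [← el, ψ.map_adj_iff]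
      exact (hw l (by omega) (by omega)).2
  refine hZ ?_
  refine (Set.Finite.biUnion (s := {s | s ∈ S ∧ s ≠ p l ∧ ¬ G.Adj s (p l)})
    (t := fun s => G.commonNeighbors s (p l)) (S.finite_toSet.subset fun s hs => hs.1)
    fun s hs => hfc hs.2.1 hs.2.2).subset fun z hz => ?_
  obtain ⟨s, h1, h2, h3, h4⟩ := hclose z hz
  exact mem_iUnion₂.2 ⟨s, ⟨h1, h3, h4⟩, mem_commonNeighbors.2 ⟨h2, (hZp z hz).1⟩⟩

theorem uniqueCommon_of_infinite (hG : GraphCHom G) (hS : FinSep G)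
    (hinf : ∀ v, (G.neighborSet v).Infinite) : UniqueCommon G := by
  have hsq : NoSquare G := (noCyc_of_infinite hG hS hinf le_rfl).noSquare
  obtain ⟨S, x, hx, c, hcS, hxc, Y, hY, hYp⟩ := exists_star_of_infinite hS hinf
  have hP3 : ∀ y ∈ Y, P3 G c x y := fun y hy => by
    obtain ⟨h1, h2, h3⟩ := hYp y hy
    refine ⟨hxc.symm, h1, ?_, fun h => h3 (.of_adj hcS h2 h)⟩
    rintro rfl
    exact h3 (.refl hcS)
  have hmaps : MapsTo (fun y => G.commonNeighbors c y) Y {T : Set V | T ⊆ S} := by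
    intro y hy s hs
    obtain ⟨h1, h2, h3⟩ := hYp y hy
    rw [mem_commonNeighbors] at hs
    by_contra hsS
    exact h3 ((Joined.of_adj hcS hsS hs.1).trans (.of_adj hsS h2 hs.2.symm))
  obtain ⟨y₁, h₁, y₂, h₂, hne, heq⟩ := hY.exists_ne_map_eq_of_mapsTo hmaps
    (S.finite_toSet.finite_subsets)
  have p₁ := hP3 y₁ h₁
  have p₂ := hP3 y₂ h₂
  exact uniqueCommon_of hG p₁ fun p hp => eq_of_commonNeighbors_eq hG hsq hxc p₁.2.1 p₂.2.1 hne
    p₁.2.2.1 p₂.2.2.1 p₁.2.2.2 p₂.2.2.2 heq hp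

end InfiniteDegree

section CliqueBlocks

variable {V : Type u} {G : SimpleGraph V}

/-- Two neighbours of `x` that are joined avoiding `x` are equal or adjacent. -/
def CliqueBlocks (G : SimpleGraph V) : Prop :=
  ∀ x y z : V, G.Adj x y → G.Adj x z → Joined G {x}ᶜ y z → y = z ∨ G.Adj y z

theorem cliqueBlocks_of (hu : UniqueCommon G) (hcyc : ∀ k, 3 ≤ k → NoCyc G k) :
    CliqueBlocks G := by
  classical
  by_contra hcon
  have hex : ∃ n, ∃ x p, IndPath G n p ∧ (∀ i ≤ n, p i ≠ x) ∧ G.Adj x (p 0) ∧ G.Adj x (p n) ∧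
      2 ≤ n := by
    unfold CliqueBlocks at hcon
    push Not at hcon
    obtain ⟨x, y, z, hxy, hxz, hj, hne, hadj⟩ := hcon
    obtain ⟨n, p, rfl, rfl, hA, hp, -⟩ := exists_indPath hj
    refine ⟨n, x, p, hp, hA, hxy, hxz, ?_⟩
    by_contra hn
    obtain rfl | rfl : n = 0 ∨ n = 1 := by omega
    · exact hne rfl
    · exact hadj (hp.adj (by omega))
  obtain ⟨x, p, hp, hpx, h0, hn, hn2⟩ := Nat.find_spec hex
  have hmin := fun m (hm : m < Nat.find hex) => Nat.find_min hex hm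
  generalize Nat.find hex = n at *
  have hinner : ∀ i, 0 < i → i < n → 3 ≤ n → ¬ G.Adj x (p i) := by
    intro i hi hin hn3 hadj
    have hi1 : i = 1 := by
      by_contra hi1
      exact hmin i hin ⟨x, p, hp.mono hin.le, fun j hj => hpx j (by omega), h0, hadj, by omega⟩
    subst hi1
    refine hmin (n - 1) (by omega) ⟨x, fun j => p (j + 1), ?_, fun j hj => hpx _ (by omega),
      hadj, ?_, by omega⟩
    · intro a b hab hb
      have := hp (a + 1) (b + 1) (by omega) (by omega)
      refine ⟨this.1, this.2.trans (by omega)⟩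
    · simpa [show n - 1 + 1 = n by omega] using hn
  rcases hn2.eq_or_lt with rfl | hn3
  · have h2 := hp 0 2 (by omega) le_rfl
    refine hpx 1 (by omega) (hu (p 0) (p 2) (p 1) x ?_ ?_)
    · exact ⟨hp.adj (by omega), hp.adj (by omega), h2.1, fun h => by simpa using h2.2.1 h⟩
    · exact ⟨h0.symm, hn, h2.1, fun h => by simpa using h2.2.1 h⟩
  · exact hcyc n hn3 p hp x h0 hn fun i hi hin => ⟨(hpx i hin.le).symm, hinner i hi hin hn3⟩

theorem _root_.GraphCHom.cliqueBlocks (hG : GraphCHom G) (hc : G.Connected)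
    (hends : MoreThanOneEnd G) : CliqueBlocks G := by
  have hS := finSep_of_not_joined hc (exists_not_joined_of_ends hends)
  have := infinite_of_ends hends
  by_cases hfin : ∃ v, (G.neighborSet v).Finite
  · obtain ⟨v, hv⟩ := hfin
    have hfin : ∀ v, (G.neighborSet v).Finite := by
      intro w
      obtain ⟨ψ, rfl⟩ := vertex_iso hG v w
      rw [← image_neighborSet]
      exact hv.image ψ
    exact cliqueBlocks_of (uniqueCommon_of_finite hG hc hfin)
      fun k hk => noCyc_of_finite hG hc hfin hk
  · push Not at hfin
    exact cliqueBlocks_of (uniqueCommon_of_infinite hG hS hfin)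
      fun k hk => noCyc_of_infinite hG hS hfin (by omega)

end CliqueBlocks

end CHom

namespace CHom

section Lines

variable {V : Type u} {G : SimpleGraph V}

/-- The vertices that are equal or adjacent to both `u` and `v`. -/
def line (G : SimpleGraph V) (u v : V) : Set V :=
  {w | (w = u ∨ G.Adj w u) ∧ (w = v ∨ G.Adj w v)}

/-- The vertices of `B` are pairwise adjacent. -/
def Clique (G : SimpleGraph V) (B : Set V) : Prop :=
  ∀ a ∈ B, ∀ b ∈ B, a = b ∨ G.Adj a b

theorem line_comm (u v : V) : line G u v = line G v u := by
  ext w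
  exact and_comm

theorem left_mem_line {u v : V} (h : G.Adj u v) : u ∈ line G u v := ⟨Or.inl rfl, Or.inr h⟩

theorem right_mem_line {u v : V} (h : G.Adj u v) : v ∈ line G u v :=
  ⟨Or.inr h.symm, Or.inl rfl⟩

theorem Clique.subset_line {B : Set V} (hB : Clique G B) {u v : V} (hu : u ∈ B) (hv : v ∈ B) :
    B ⊆ line G u v := fun w hw => ⟨hB w hw u hu, hB w hw v hv⟩

theorem Clique.joined {B : Set V} (hB : Clique G B) :
    ∀ x ∈ B, ∀ y ∈ B, Joined G B x y := by
  intro x hx y hy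
  rcases hB x hx y hy with rfl | h
  · exact .refl hx
  · exact .of_adj hx hy h

theorem Clique.mono {B B' : Set V} (hB : Clique G B) (h : B' ⊆ B) : Clique G B' :=
  fun a ha b hb => hB a (h ha) b (h hb)

theorem CliqueBlocks.of_set (hC : CliqueBlocks G) {A : Set V} {x y z : V} (hx : x ∉ A)
    (hA : ∀ y ∈ A, ∀ z ∈ A, Joined G A y z) (hy : y ∈ A) (hz : z ∈ A) (hxy : G.Adj x y)
    (hxz : G.Adj x z) : y = z ∨ G.Adj y z :=
  hC x y z hxy hxz ((hA y hy z hz).mono fun a ha => by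
    rintro rfl
    exact hx ha)

theorem CliqueBlocks.trans (hC : CliqueBlocks G) {x a b c : V} (ha : G.Adj x a) (hb : G.Adj x b)
    (hc : G.Adj x c) (hab : a = b ∨ G.Adj a b) (hbc : b = c ∨ G.Adj b c) :
    a = c ∨ G.Adj a c := by
  rcases hab with rfl | hab
  · exact hbc
  rcases hbc with rfl | hbc
  · exact Or.inr hab
  exact hC x a c ha hc ((Joined.of_adj ha.ne' hb.ne' hab).trans (.of_adj hb.ne' hc.ne' hbc))

theorem CliqueBlocks.clique_line (hC : CliqueBlocks G) {u v : V} (huv : G.Adj u v) :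
    Clique G (line G u v) := by
  rintro a ⟨rfl | hau, ha⟩ b ⟨hbu, hb⟩
  · exact hbu.imp Eq.symm SimpleGraph.Adj.symm
  rcases hbu with rfl | hbu
  · exact Or.inr hau
  exact hC.trans hau.symm huv hbu.symm ha (hb.imp Eq.symm SimpleGraph.Adj.symm)

theorem CliqueBlocks.line_eq (hC : CliqueBlocks G) {u v a b : V} (huv : G.Adj u v)
    (ha : a ∈ line G u v) (hb : b ∈ line G u v) (hab : a ≠ b) : line G a b = line G u v := by
  have hcl := hC.clique_line huv
  have hab' : G.Adj a b := (hcl a ha b hb).resolve_left hab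
  refine Subset.antisymm ?_ (hcl.subset_line ha hb)
  exact (hC.clique_line hab').subset_line (hcl.subset_line ha hb (left_mem_line huv))
    (hcl.subset_line ha hb (right_mem_line huv))

theorem CliqueBlocks.clique_of_block (hC : CliqueBlocks G) {B : Set V}
    (hB : (G.induce B).Connected) (hB' : ∀ v ∈ B, (G.induce (B \ {v})).Preconnected) :
    Clique G B := by
  intro y hy z hz
  obtain ⟨n, p, rfl, rfl, hA, hp, -⟩ := exists_indPath ((connected_iff.1 hB).2 y hy z hz)
  rcases (by omega : n = 0 ∨ n = 1 ∨ 2 ≤ n) with rfl | rfl | hn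
  · exact Or.inl rfl
  · exact Or.inr (hp.adj (by omega))
  exfalso
  have h01 := hp.adj (show 0 < n by omega)
  have h12 := hp.adj (show 1 < n by omega)
  have h02 := hp 0 2 (by omega) hn
  have hj := preconnected_iff.1 (hB' (p 1) (hA 1 (by omega))) (p 0)
    ⟨hA 0 (by omega), h01.ne⟩ (p 2) ⟨hA 2 hn, h12.ne'⟩
  rcases hC (p 1) (p 0) (p 2) h01.symm h12 (hj.mono fun a ha => ha.2) with h | h
  · exact h02.1 h
  · simpa using h02.2.1 h

theorem CliqueBlocks.isBlockOf_line (hC : CliqueBlocks G) {u v : V} (huv : G.Adj u v) :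
    IsBlockOf G (line G u v) := by
  have hcl := hC.clique_line huv
  have hne : (line G u v).Nonempty := ⟨u, left_mem_line huv⟩
  refine ⟨hne, connected_iff.2 ⟨hne, hcl.joined⟩, fun w _ =>
    preconnected_iff.2 (hcl.mono sdiff_subset).joined, fun B' hB hc hcut => ?_⟩
  exact Subset.antisymm ((hC.clique_of_block hc hcut).subset_line (hB (left_mem_line huv))
    (hB (right_mem_line huv))) hB

theorem CliqueBlocks.isBlockOf_iff (hC : CliqueBlocks G) (hnbr : ∀ v, ∃ w, G.Adj v w)
    {B : Set V} : IsBlockOf G B ↔ ∃ u v, G.Adj u v ∧ B = line G u v := by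
  constructor
  · rintro ⟨⟨b, hb⟩, hc, hcut, hmax⟩
    have hcl := hC.clique_of_block hc hcut
    have : ∃ c, G.Adj b c ∧ B ⊆ line G b c := by
      by_cases h : ∃ c ∈ B, c ≠ b
      · obtain ⟨c, hcB, hcb⟩ := h
        exact ⟨c, (hcl b hb c hcB).resolve_left hcb.symm, hcl.subset_line hb hcB⟩
      · push Not at h
        obtain ⟨c, hc⟩ := hnbr b
        refine ⟨c, hc, fun d hd => ?_⟩
        rw [h d hd]
        exact left_mem_line hc
    obtain ⟨c, hbc, hsub⟩ := this
    have := hC.isBlockOf_line hbc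
    exact ⟨b, c, hbc, (hmax _ hsub this.2.1 this.2.2.1).symm⟩
  · rintro ⟨u, v, huv, rfl⟩
    exact hC.isBlockOf_line huv

theorem CliqueBlocks.isTree (hC : CliqueBlocks G) (hc : G.Connected)
    (htri : ∀ x y z, G.Adj x y → G.Adj y z → ¬ G.Adj x z) : G.IsTree := by
  refine ⟨hc, SimpleGraph.isAcyclic_iff_forall_adj_isBridge.2 fun u v huv => ?_⟩
  rw [SimpleGraph.isBridge_iff]
  intro hr
  obtain ⟨n, p, rfl, rfl, -, hp, -⟩ := exists_indPath (Joined.of_reachable hr)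
  have hn : 0 < n := by
    rcases n.eq_zero_or_pos with rfl | h
    · exact absurd rfl huv.ne
    · exact h
  have hle : ∀ {x y}, (G.deleteEdges {s(p 0, p n)}).Adj x y → G.Adj x y := fun h =>
    SimpleGraph.deleteEdges_le _ h
  have h1 := hp.adj hn
  have hj : Joined G {p 0}ᶜ (p 1) (p n) := .of_fun hn
    (fun i hi hi' => (hp 0 i hi hi').1.symm) (fun i hi hi' => hle (hp.adj hi'))
  rcases hC _ _ _ (hle h1) huv hj with h | h
  · rw [SimpleGraph.deleteEdges_adj] at h1
    simp only [zero_add] at h1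
    exact h1.2 (by rw [h]; simp)
  · exact htri _ _ _ (hle h1) h huv

end Lines

section Automorphisms

variable {V : Type u} {R : V → V → Prop}

/-- `ψ` is an automorphism of the relation `R`. -/
def IsAut (R : V → V → Prop) (ψ : Equiv.Perm V) : Prop := ∀ x y, R (ψ x) (ψ y) ↔ R x y

theorem IsAut.adj {ψ : Equiv.Perm V} (h : IsAut R ψ) {x y : V} :
    (UG R).Adj (ψ x) (ψ y) ↔ (UG R).Adj x y := by
  simp only [UG, SimpleGraph.fromRel_adj, h x y, h y x, ne_eq, ψ.injective.eq_iff]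

theorem IsAut.image_line {ψ : Equiv.Perm V} (h : IsAut R ψ) (u v : V) :
    ψ '' line (UG R) u v = line (UG R) (ψ u) (ψ v) := by
  ext w
  obtain ⟨w, rfl⟩ := ψ.surjective w
  rw [ψ.injective.mem_set_image]
  simp only [line, mem_ofPred_eq, h.adj, ψ.injective.eq_iff]

theorem _root_.DigraphCHom.vertex (h : DigraphCHom R) (hR : ∀ x, ¬ R x x) (v w : V) :
    ∃ ψ, IsAut R ψ ∧ ψ v = w := by
  obtain ⟨ψ, hψ, hψ'⟩ := h.tuple (ι := Fin 1) (u := fun _ => v) (u' := fun _ => w)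
    (fun i j _ => Subsingleton.elim _ _) (fun i j _ => Subsingleton.elim _ _)
    (fun i j => by simp [hR])
    (connected_range_star (i := 0) fun j hj => absurd (Subsingleton.elim _ _) hj)
  exact ⟨ψ, hψ, hψ' 0⟩

theorem _root_.DigraphCHom.edge (h : DigraphCHom R) (hR : IsDigraph R) {v w v' w' : V} (hvw : R v w)
    (hvw' : R v' w') : ∃ ψ, IsAut R ψ ∧ ψ v = v' ∧ ψ w = w' := by
  have inj : ∀ {v w : V}, R v w → Function.Injective ![v, w] := by
    intro v w h i j hij
    have : v ≠ w := by
      rintro rfl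
      exact hR.1 _ h
    fin_cases i <;> fin_cases j <;> simp_all [this.symm]
  obtain ⟨ψ, hψ, hψ'⟩ := h.tuple (ι := Fin 2) (u := ![v, w]) (u' := ![v', w'])
    (inj hvw) (inj hvw')
    (fun i j => by
      fin_cases i <;> fin_cases j <;>
        simp [hR.1, hvw, hvw', hR.2 _ _ hvw, hR.2 _ _ hvw'])
    (connected_range_star (i := 0) fun j hj => by
      fin_cases j
      · simp at hj
      · simpa using (UG_adj_iff hR.1).2 (Or.inl hvw))
  exact ⟨ψ, hψ, hψ' 0, hψ' 1⟩

theorem _root_.DigraphCHom.triangle (h : DigraphCHom R) (hR : IsDigraph R) {a b c c' : V}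
    (hab : R a b) (hac : (UG R).Adj a c) (hbc : (UG R).Adj b c) (hac' : (UG R).Adj a c')
    (hbc' : (UG R).Adj b c') (h₁ : R a c ↔ R a c') (h₂ : R b c ↔ R b c') :
    ∃ ψ, IsAut R ψ ∧ ψ a = a ∧ ψ b = b ∧ ψ c = c' := by
  have hne : a ≠ b := by
    rintro rfl
    exact hR.1 _ hab
  have inj : ∀ {c : V}, (UG R).Adj a c → (UG R).Adj b c → Function.Injective ![a, b, c] := by
    intro c hac hbc i j hij
    fin_cases i <;> fin_cases j <;>
      simp_all [hne.symm, hac.ne, hbc.ne, hac.ne', hbc.ne']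
  have rev : ∀ {a b c : V}, (UG R).Adj b a → (UG R).Adj c a → (R b a ↔ R c a) →
      (R a b ↔ R a c) := by
    intro a b c h h' hiff
    rw [UG_adj_iff hR.1] at h h'
    have := hR.2 a b
    have := hR.2 a c
    tauto
  have ca : R c a ↔ R c' a := by
    rw [UG_adj_iff hR.1] at hac hac'
    have := hR.2 a c
    have := hR.2 a c'
    tauto
  have cb : R c b ↔ R c' b := by
    rw [UG_adj_iff hR.1] at hbc hbc'
    have := hR.2 b c
    have := hR.2 b c'
    tauto
  obtain ⟨ψ, hψ, hψ'⟩ := h.tuple (ι := Fin 3) (u := ![a, b, c]) (u' := ![a, b, c'])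
    (inj hac hbc) (inj hac' hbc')
    (fun i j => by
      fin_cases i <;> fin_cases j <;> simp [hR.1, h₁, h₂, ca, cb])
    (connected_range_star (i := 0) fun j hj => by
      fin_cases j
      · simp at hj
      · simpa using (UG_adj_iff hR.1).2 (Or.inl hab)
      · simpa using hac)
  exact ⟨ψ, hψ, hψ' 0, hψ' 1, hψ' 2⟩

end Automorphisms

section FiniteTournaments

variable {V : Type u} {R : V → V → Prop}

/-- A finite tournament with transitive automorphism group is regular of odd order. -/
theorem card_eq_of_transitive [DecidableRel R] (hR : IsDigraph R) {U : Finset V}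
    (hU : IsTournamentOn R U)
    (htr : ∀ a ∈ U, ∀ b ∈ U, ∃ ψ, IsAut R ψ ∧ (∀ x, ψ x ∈ U ↔ x ∈ U) ∧ ψ a = b)
    (hne : U.Nonempty) :
    ∃ k, U.card = 2 * k + 1 ∧ ∀ a ∈ U, (U.filter fun x => R a x).card = k := by
  classical
  obtain ⟨a, ha⟩ := hne
  have hout : ∀ b ∈ U, (U.filter fun x => R b x).card = (U.filter fun x => R a x).card := by
    intro b hb
    obtain ⟨ψ, hψ, hψU, rfl⟩ := htr a ha b hb
    symm
    refine Finset.card_bij (fun x _ => ψ x) ?_ (fun x _ y _ h => ψ.injective h) ?_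
    · intro x hx
      rw [Finset.mem_filter] at hx ⊢
      exact ⟨(hψU x).2 hx.1, (hψ a x).2 hx.2⟩
    · intro y hy
      obtain ⟨x, rfl⟩ := ψ.surjective y
      rw [Finset.mem_filter] at hy
      exact ⟨x, Finset.mem_filter.2 ⟨(hψU x).1 hy.1, (hψ a x).1 hy.2⟩, rfl⟩
  have hin : ∀ b ∈ U, (U.filter fun x => R x b).card = (U.filter fun x => R x a).card := by
    intro b hb
    obtain ⟨ψ, hψ, hψU, rfl⟩ := htr a ha b hb
    symm
    refine Finset.card_bij (fun x _ => ψ x) ?_ (fun x _ y _ h => ψ.injective h) ?_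
    · intro x hx
      rw [Finset.mem_filter] at hx ⊢
      exact ⟨(hψU x).2 hx.1, (hψ x a).2 hx.2⟩
    · intro y hy
      obtain ⟨x, rfl⟩ := ψ.surjective y
      rw [Finset.mem_filter] at hy
      exact ⟨x, Finset.mem_filter.2 ⟨(hψU x).1 hy.1, (hψ x a).1 hy.2⟩, rfl⟩
  have hsum := Finset.sum_card_bipartiteAbove_eq_sum_card_bipartiteBelow (s := U) (t := U) R
  have e1 : ∑ x ∈ U, (Finset.bipartiteAbove R U x).card =
      U.card * (U.filter fun x => R a x).card := by
    rw [← smul_eq_mul, ← Finset.sum_const]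
    exact Finset.sum_congr rfl hout
  have e2 : ∑ x ∈ U, (Finset.bipartiteBelow R U x).card =
      U.card * (U.filter fun x => R x a).card := by
    rw [← smul_eq_mul, ← Finset.sum_const]
    exact Finset.sum_congr rfl hin
  rw [e1, e2] at hsum
  have heq := Nat.eq_of_mul_eq_mul_left (Finset.card_pos.2 ⟨a, ha⟩) hsum
  refine ⟨_, ?_, hout⟩
  have hunion : U = insert a ((U.filter fun x => R a x) ∪ U.filter fun x => R x a) := by
    ext x
    simp only [Finset.mem_insert, Finset.mem_union, Finset.mem_filter]
    constructor
    · intro hx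
      by_cases h : x = a
      · exact Or.inl h
      · rcases hU x hx a ha h with h | h
        · exact Or.inr (Or.inr ⟨hx, h⟩)
        · exact Or.inr (Or.inl ⟨hx, h⟩)
    · rintro (rfl | h | h)
      exacts [ha, h.1, h.1]
  have hdisj : Disjoint (U.filter fun x => R a x) (U.filter fun x => R x a) := by
    rw [Finset.disjoint_left]
    intro x hx hx'
    exact hR.2 _ _ (Finset.mem_filter.1 hx).2 (Finset.mem_filter.1 hx').2
  conv_lhs => rw [hunion]
  rw [Finset.card_insert_of_notMem (by simp [hR.1]), Finset.card_union_of_disjoint hdisj, ← heq]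
  omega

theorem card_eq_three (hR : IsDigraph R) {U : Finset V} (hU : IsTournamentOn R U)
    (h3 : 3 ≤ U.card)
    (h₁ : ∀ a ∈ U, ∀ b ∈ U, ∃ ψ, IsAut R ψ ∧ (∀ x, ψ x ∈ U ↔ x ∈ U) ∧ ψ a = b)
    (h₂ : ∀ a ∈ U, ∀ b ∈ U, ∀ b' ∈ U, R a b → R a b' →
      ∃ ψ, IsAut R ψ ∧ (∀ x, ψ x ∈ U ↔ x ∈ U) ∧ ψ a = a ∧ ψ b = b')
    (h₃ : ∀ a ∈ U, ∀ b ∈ U, ∀ c ∈ U, ∀ c' ∈ U, R a b → R b c → R b c' → c ≠ a → c' ≠ a →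
      (R a c ↔ R a c') →
      ∃ ψ, IsAut R ψ ∧ (∀ x, ψ x ∈ U ↔ x ∈ U) ∧ ψ a = a ∧ ψ b = b ∧ ψ c = c') :
    U.card = 3 := by
  classical
  obtain ⟨k, hk, hk'⟩ := card_eq_of_transitive hR hU h₁ (Finset.card_pos.1 (by omega))
  obtain ⟨a, ha⟩ := Finset.card_pos.1 (show 0 < U.card by omega)
  have hsub : ∀ (p : V → Prop) [DecidablePred p], IsTournamentOn R (U.filter p : Finset V) :=
    fun p _ x hx y hy =>
    hU x (Finset.mem_filter.1 hx).1 y (Finset.mem_filter.1 hy).1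
  obtain ⟨m, hm, hm'⟩ := card_eq_of_transitive hR (hsub fun x => R a x)
    (fun b hb b' hb' => by
      rw [Finset.mem_filter] at hb hb'
      obtain ⟨ψ, hψ, hψU, hψa, hψb⟩ := h₂ a ha b hb.1 b' hb'.1 hb.2 hb'.2
      refine ⟨ψ, hψ, fun x => ?_, hψb⟩
      rw [Finset.mem_filter, Finset.mem_filter, hψU, ← hψ a x, hψa])
    (Finset.card_pos.1 (by rw [hk' a ha]; omega))
  rw [hk' a ha] at hm
  obtain ⟨b, hb⟩ := Finset.card_pos.1 (show 0 < (U.filter fun x => R a x).card by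
    rw [hk' a ha]; omega)
  have hmb := hm' b hb
  rw [Finset.mem_filter] at hb
  rw [Finset.filter_filter] at hmb
  -- the out-neighbours of `b` split into those dominated by `a` and those dominating `a`
  have hsplit : (U.filter fun x => R a x ∧ R b x).card + (U.filter fun x => R b x ∧ ¬ R a x).card
      = k := by
    rw [← hk' b hb.1, ← Finset.card_filter_add_card_filter_not (s := U.filter fun x => R b x)
      (fun x => R a x), Finset.filter_filter, Finset.filter_filter]
    simp only [and_comm]
  have hne : ∀ x, R b x → x ≠ a := by
    rintro x h rfl
    exact hR.2 _ _ hb.2 h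
  obtain ⟨l, hl, -⟩ := card_eq_of_transitive hR (hsub fun x => R b x ∧ ¬ R a x)
    (fun c hc c' hc' => by
      rw [Finset.mem_filter] at hc hc'
      obtain ⟨ψ, hψ, hψU, hψa, hψb, hψc⟩ := h₃ a ha b hb.1 c hc.1 c' hc'.1 hb.2 hc.2.1 hc'.2.1
        (hne c hc.2.1) (hne c' hc'.2.1) (iff_of_false hc.2.2 hc'.2.2)
      refine ⟨ψ, hψ, fun x => ?_, hψc⟩
      rw [Finset.mem_filter, Finset.mem_filter, hψU, ← hψ a x, ← hψ b x, hψa, hψb])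
    (Finset.card_pos.1 (by omega))
  rcases Nat.eq_zero_or_pos m with rfl | hmpos
  · omega
  obtain ⟨l', hl', -⟩ := card_eq_of_transitive hR (hsub fun x => R a x ∧ R b x)
    (fun c hc c' hc' => by
      rw [Finset.mem_filter] at hc hc'
      obtain ⟨ψ, hψ, hψU, hψa, hψb, hψc⟩ := h₃ a ha b hb.1 c hc.1 c' hc'.1 hb.2 hc.2.2 hc'.2.2
        (hne c hc.2.2) (hne c' hc'.2.2) (iff_of_true hc.2.1 hc'.2.1)
      refine ⟨ψ, hψ, fun x => ?_, hψc⟩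
      rw [Finset.mem_filter, Finset.mem_filter, hψU, ← hψ a x, ← hψ b x, hψa, hψb])
    (Finset.card_pos.1 (by omega))
  omega

end FiniteTournaments

end CHom

namespace CHom

section Forward

variable {V : Type u} {E : V → V → Prop}

theorem tournament_of_clique (hE : ∀ x, ¬ E x x) {B : Set V} (hB : Clique (UG E) B) :
    IsTournamentOn E B := fun a ha b hb hab =>
  (UG_adj_iff hE).1 ((hB a ha b hb).resolve_left hab)

theorem IsAut.mem_line_iff (hC : CliqueBlocks (UG E)) {ψ : Equiv.Perm V} (hψ : IsAut E ψ)
    {u v a a' : V} (huv : (UG E).Adj u v) (ha : a ∈ line (UG E) u v) (ha' : a' ∈ line (UG E) u v)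
    (hne : a ≠ a') (hb : ψ a ∈ line (UG E) u v) (hb' : ψ a' ∈ line (UG E) u v) (x : V) :
    ψ x ∈ line (UG E) u v ↔ x ∈ line (UG E) u v := by
  have h := hψ.image_line a a'
  rw [hC.line_eq huv ha ha' hne, hC.line_eq huv hb hb' (fun h => hne (ψ.injective h))] at h
  conv_lhs => rw [← h]
  exact ψ.injective.mem_set_image

theorem exists_directed_path (hD : IsDigraph E) (h : HasTriangle E) :
    ∃ p q r, E p q ∧ E q r ∧ (UG E).Adj p r := by
  obtain ⟨x, y, z, h1, h2, h3⟩ := h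
  rcases (UG_adj_iff hD.1).1 h1 with hxy | hyx <;> rcases (UG_adj_iff hD.1).1 h2 with hyz | hzy
  · exact ⟨x, y, z, hxy, hyz, h3⟩
  · rcases (UG_adj_iff hD.1).1 h3 with hxz | hzx
    · exact ⟨x, z, y, hxz, hzy, h1⟩
    · exact ⟨z, x, y, hzx, hxy, h2.symm⟩
  · rcases (UG_adj_iff hD.1).1 h3 with hxz | hzx
    · exact ⟨y, x, z, hyx, hxz, h2⟩
    · exact ⟨y, z, x, hyz, hzx, h1.symm⟩
  · exact ⟨z, y, x, hzy, hyx, h3.symm⟩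

theorem exists_out_mem_line (hD : IsDigraph E) (hE : DigraphCHom E) (hC : CliqueBlocks (UG E))
    (htri : HasTriangle E) {u v a : V} (huv : (UG E).Adj u v) (ha : a ∈ line (UG E) u v) :
    ∃ b ∈ line (UG E) u v, E a b := by
  obtain ⟨c, hc, hca⟩ : ∃ c ∈ line (UG E) u v, c ≠ a := by
    by_cases h : u = a
    · exact ⟨v, right_mem_line huv, fun h' => huv.ne (h.trans h'.symm)⟩
    · exact ⟨u, left_mem_line huv, h⟩
  rcases tournament_of_clique hD.1 (hC.clique_line huv) a ha c hc hca.symm with hac | hac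
  · exact ⟨c, hc, hac⟩
  obtain ⟨p, q, r, hpq, hqr, hpr⟩ := exists_directed_path hD htri
  obtain ⟨ψ, hψ, rfl, rfl⟩ := hE.edge hD hpq hac
  refine ⟨ψ r, ?_, (hψ _ _).2 hqr⟩
  rw [← hC.line_eq huv hc ha hca]
  exact ⟨Or.inr (hψ.adj.2 hpr.symm),
    Or.inr (hψ.adj.2 ((UG_adj_iff hD.1).2 (Or.inr hqr)))⟩

theorem homogeneousOn_line (hD : IsDigraph E) (hE : DigraphCHom E) (hC : CliqueBlocks (UG E))
    (htri : HasTriangle E) {u v : V} (huv : (UG E).Adj u v) :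
    HomogeneousOn E (line (UG E) u v) := by
  intro X Y hX hY φ hφ
  have hcl := hC.clique_line huv
  -- it suffices to find a suitable automorphism of the whole digraph
  have key : ∀ ψ : Equiv.Perm V, IsAut E ψ → (∃ a ∈ line (UG E) u v, ∃ a' ∈ line (UG E) u v,
      a ≠ a' ∧ ψ a ∈ line (UG E) u v ∧ ψ a' ∈ line (UG E) u v) →
      (∀ a : X, ψ a.1.1 = (φ a).1.1) →
      ∃ ψ : Equiv.Perm (line (UG E) u v), (∀ x y, E (ψ x).1 (ψ y).1 ↔ E x.1 y.1) ∧
        ∀ a : X, ψ a.1 = (φ a).1 := by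
    rintro ψ hψ ⟨a, ha, a', ha', hne, hb, hb'⟩ hψφ
    exact ⟨ψ.subtypePerm (hψ.mem_line_iff hC huv ha ha' hne hb hb'),
      fun x y => hψ x.1 y.1, fun a => Subtype.ext (hψφ a)⟩
  rcases X.eq_empty_or_nonempty with rfl | ⟨a, ha⟩
  · exact ⟨1, fun x y => Iff.rfl, fun a => a.2.elim⟩
  by_cases hex : ∃ a' ∈ X, a ≠ a'
  · obtain ⟨a', ha', hne⟩ := hex
    have hφne : (φ ⟨a, ha⟩).1.1 ≠ (φ ⟨a', ha'⟩).1.1 := fun h =>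
      hne (congrArg Subtype.val (φ.injective (Subtype.ext (Subtype.ext h))))
    have : Finite X := hX
    obtain ⟨ψ, hψ, hψ'⟩ := hE.tuple (ι := X) (u := fun x => x.1.1) (u' := fun x => (φ x).1.1)
      (fun x y h => Subtype.ext (Subtype.ext h))
      (fun x y h => φ.injective (Subtype.ext (Subtype.ext h))) hφ
      (connected_iff.2 ⟨⟨_, mem_range_self ⟨a, ha⟩⟩, (hcl.mono (by
        rintro _ ⟨x, rfl⟩
        exact x.1.2)).joined⟩)
    refine key ψ hψ ⟨a, a.2, a', a'.2, fun h => hne (Subtype.ext h), ?_, ?_⟩ hψ'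
    · rw [hψ' ⟨a, ha⟩]
      exact Subtype.property _
    · rw [hψ' ⟨a', ha'⟩]
      exact Subtype.property _
  · push Not at hex
    obtain ⟨b, hb, hab⟩ := exists_out_mem_line hD hE hC htri huv a.2
    obtain ⟨b', hb', hab'⟩ := exists_out_mem_line hD hE hC htri huv (φ ⟨a, ha⟩).1.2
    obtain ⟨ψ, hψ, h1, h2⟩ := hE.edge hD hab hab'
    refine key ψ hψ ⟨a, a.2, b, hb, ?_, ?_, ?_⟩ ?_
    · intro h
      rw [← h] at hab
      exact hD.1 _ hab
    · rw [h1]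
      exact Subtype.property _
    · rw [h2]
      exact hb'
    · rintro ⟨x, hx⟩
      obtain rfl := hex x hx
      exact h1

theorem ncard_line_eq_three (hD : IsDigraph E) (hE : DigraphCHom E) (hC : CliqueBlocks (UG E))
    (htri : HasTriangle E) {u v : V} (huv : (UG E).Adj u v)
    (hfin : (line (UG E) u v).Finite) (h3 : 3 ≤ hfin.toFinset.card) :
    hfin.toFinset.card = 3 := by
  have hcl := hC.clique_line huv
  have hadj : ∀ {x y}, E x y → (UG E).Adj x y := fun h => (UG_adj_iff hD.1).2 (Or.inl h)
  have hne : ∀ {x y}, E x y → x ≠ y := fun h => (hadj h).ne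
  refine card_eq_three hD (U := hfin.toFinset) (by
    rw [hfin.coe_toFinset]
    exact tournament_of_clique hD.1 hcl) h3 ?_ ?_ ?_
  · simp only [hfin.mem_toFinset]
    intro a ha b hb
    obtain ⟨a', ha', haa⟩ := exists_out_mem_line hD hE hC htri huv ha
    obtain ⟨b', hb', hbb⟩ := exists_out_mem_line hD hE hC htri huv hb
    obtain ⟨ψ, hψ, rfl, rfl⟩ := hE.edge hD haa hbb
    exact ⟨ψ, hψ, hψ.mem_line_iff hC huv ha ha' (hne haa) hb hb', rfl⟩
  · simp only [hfin.mem_toFinset]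
    intro a ha b hb b' hb' hab hab'
    obtain ⟨ψ, hψ, h1, rfl⟩ := hE.edge hD hab hab'
    exact ⟨ψ, hψ, hψ.mem_line_iff hC huv ha hb (hne hab) (by rwa [h1]) hb', h1, rfl⟩
  · simp only [hfin.mem_toFinset]
    intro a ha b hb c hc c' hc' hab hbc hbc' hca hca' hiff
    obtain ⟨ψ, hψ, h1, h2, rfl⟩ := hE.triangle hD hab
      ((hcl a ha c hc).resolve_left hca.symm) (hadj hbc)
      ((hcl a ha c' hc').resolve_left hca'.symm) (hadj hbc') hiff (iff_of_true hbc hbc')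
    exact ⟨ψ, hψ, hψ.mem_line_iff hC huv ha hb (hne hab) (by rwa [h1]) (by rwa [h2]), h1, h2, rfl⟩

theorem IsAut.isBlockOf_image (hC : CliqueBlocks (UG E)) (hnbr : ∀ v, ∃ w, (UG E).Adj v w)
    {ψ : Equiv.Perm V} (hψ : IsAut E ψ) {B : Set V} :
    IsBlockOf (UG E) (ψ '' B) ↔ IsBlockOf (UG E) B := by
  simp only [hC.isBlockOf_iff hnbr]
  constructor
  · rintro ⟨u, v, huv, h⟩
    obtain ⟨u, rfl⟩ := ψ.surjective u
    obtain ⟨v, rfl⟩ := ψ.surjective v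
    rw [← hψ.image_line] at h
    exact ⟨u, v, hψ.adj.1 huv, ψ.injective.image_injective h⟩
  · rintro ⟨u, v, huv, rfl⟩
    exact ⟨_, _, hψ.adj.2 huv, hψ.image_line u v⟩

theorem IsAut.degree_equiv {ψ : Equiv.Perm V} (hψ : IsAut E ψ) (v : V) :
    Nonempty ({y : V // E v y} ≃ {y : V // E (ψ v) y}) :=
  ⟨ψ.subtypeEquiv fun a => (hψ v a).symm⟩

theorem IsAut.swap {ψ : Equiv.Perm V} (hψ : IsAut E ψ) : IsAut (fun x y => E y x) ψ :=
  fun x y => hψ y x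

theorem forward (hD : IsDigraph E) (hconn : (UG E).Connected) (hends : MoreThanOneEnd (UG E))
    (hE : DigraphCHom E) (hG : GraphCHom (UG E)) :
      (((UG E).IsTree ∧
          (∀ v w : V, Nonempty ({y : V // E v y} ≃ {y : V // E w y})) ∧
          (∀ v w : V, Nonempty ({y : V // E y v} ≃ {y : V // E y w}))) ∨
        (∃ κ lam : Cardinal.{u}, 2 ≤ lam ∧ (κ = 3 ∨ Cardinal.aleph0 ≤ κ) ∧
          (∀ B : Set V, IsBlockOf (UG E) B →
            IsTournamentOn E B ∧ HomogeneousOn E B ∧ Cardinal.mk B = κ) ∧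
          (∀ B B' : Set V, IsBlockOf (UG E) B → IsBlockOf (UG E) B' →
            ∃ f : B ≃ B', ∀ a b : B, E a.1 b.1 ↔ E (f a).1 (f b).1) ∧
          (∀ v : V, Cardinal.mk {B : Set V // IsBlockOf (UG E) B ∧ v ∈ B} = lam))) := by
  have hC := hG.cliqueBlocks hconn hends
  obtain ⟨S, x, hx, c, c', hcS, hcS', hxc, hxc', hcc⟩ :=
    finSep_of_not_joined hconn (exists_not_joined_of_ends hends)
  have hnbr : ∀ v, ∃ w, (UG E).Adj v w := by
    intro v
    obtain ⟨ψ, hψ, rfl⟩ := hE.vertex hD.1 x v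
    exact ⟨ψ c, hψ.adj.2 hxc⟩
  by_cases htri : HasTriangle E
  · right
    have hiso : ∀ B B' : Set V, IsBlockOf (UG E) B → IsBlockOf (UG E) B' →
        ∃ ψ, IsAut E ψ ∧ ψ '' B = B' := by
      intro B B' hB hB'
      have orient : ∀ B, IsBlockOf (UG E) B → ∃ u v, E u v ∧ B = line (UG E) u v := by
        intro B hB
        obtain ⟨u, v, huv, rfl⟩ := (hC.isBlockOf_iff hnbr).1 hB
        rcases (UG_adj_iff hD.1).1 huv with h | h
        · exact ⟨u, v, h, rfl⟩
        · exact ⟨v, u, h, line_comm u v⟩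
      obtain ⟨u, v, huv, rfl⟩ := orient B hB
      obtain ⟨u', v', huv', rfl⟩ := orient B' hB'
      obtain ⟨ψ, hψ, rfl, rfl⟩ := hE.edge hD huv huv'
      exact ⟨ψ, hψ, hψ.image_line u v⟩
    have hBx := hC.isBlockOf_line hxc
    refine ⟨Cardinal.mk (line (UG E) x c), Cardinal.mk {B : Set V // IsBlockOf (UG E) B ∧ x ∈ B},
      ?_, ?_, ?_, ?_, ?_⟩
    · rw [Cardinal.two_le_iff]
      refine ⟨⟨_, hBx, left_mem_line hxc⟩, ⟨_, hC.isBlockOf_line hxc', left_mem_line hxc'⟩,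
        fun h => ?_⟩
      have h' : c ∈ line (UG E) x c' := by
        have h'' : line (UG E) x c = line (UG E) x c' := congrArg Subtype.val h
        rw [← h'']
        exact right_mem_line hxc
      rcases h'.2 with rfl | h'
      · exact hcc (.refl hcS)
      · exact hcc (.of_adj hcS hcS' h')
    · rcases (line (UG E) x c).finite_or_infinite with hfin | hinf
      · left
        rw [← Set.cast_ncard hfin]
        have h3 : 3 ≤ hfin.toFinset.card := by
          obtain ⟨p, q, r, hpq, hqr, hpr⟩ := id htri
          obtain ⟨ψ, hψ, himg⟩ := hiso _ _ (hC.isBlockOf_line hpq) hBx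
          have hmem : ∀ y ∈ line (UG E) p q, ψ y ∈ hfin.toFinset := fun y hy => by
            rw [hfin.mem_toFinset, ← himg]
            exact mem_image_of_mem _ hy
          rw [← Nat.lt_iff_add_one_le, Finset.two_lt_card]
          refine ⟨ψ p, hmem _ (left_mem_line hpq), ψ q, hmem _ (right_mem_line hpq), ψ r,
            hmem _ ⟨Or.inr hpr.symm, Or.inr hqr.symm⟩, ?_, ?_, ?_⟩
          exacts [fun h => hpq.ne (ψ.injective h), fun h => hpr.ne (ψ.injective h),
            fun h => hqr.ne (ψ.injective h)]
        rw [ncard_eq_toFinset_card _ hfin, ncard_line_eq_three hD hE hC htri hxc hfin h3]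
        norm_num
      · right
        rw [Cardinal.aleph0_le_mk_iff]
        exact hinf.to_subtype
    · intro B hB
      obtain ⟨ψ, -, himg⟩ := hiso B _ hB hBx
      obtain ⟨u, v, huv, rfl⟩ := (hC.isBlockOf_iff hnbr).1 hB
      refine ⟨tournament_of_clique hD.1 (hC.clique_line huv),
        homogeneousOn_line hD hE hC htri huv, ?_⟩
      rw [← himg]
      exact (Cardinal.mk_image_eq ψ.injective).symm
    · intro B B' hB hB'
      obtain ⟨ψ, hψ, rfl⟩ := hiso B B' hB hB'
      exact ⟨ψ.image B, fun a b => (hψ a b).symm⟩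
    · intro v
      obtain ⟨ψ, hψ, rfl⟩ := hE.vertex hD.1 v x
      refine Cardinal.mk_congr ((Equiv.Set.congr ψ).subtypeEquiv fun B => ?_)
      change _ ↔ IsBlockOf (UG E) (ψ '' B) ∧ ψ v ∈ ψ '' B
      rw [hψ.isBlockOf_image hC hnbr, ψ.injective.mem_set_image]
  · left
    refine ⟨hC.isTree hconn fun a b c h1 h2 h3 => htri ⟨a, b, c, h1, h2, h3⟩, ?_, ?_⟩
    · intro v w
      obtain ⟨ψ, hψ, rfl⟩ := hE.vertex hD.1 v w
      exact hψ.degree_equiv v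
    · intro v w
      obtain ⟨ψ, hψ, rfl⟩ := hE.vertex hD.1 v w
      exact hψ.swap.degree_equiv v

end Forward

end CHom

namespace CHom

section Extension

variable {V : Type u} {R : V → V → Prop} {G : SimpleGraph V}

/-- `F` is the graph of an isomorphism between two induced substructures of `R`. -/
def PIso (R : V → V → Prop) (F : Set (V × V)) : Prop :=
  ∀ p ∈ F, ∀ q ∈ F, (p.1 = q.1 ↔ p.2 = q.2) ∧ (R p.1 q.1 ↔ R p.2 q.2)

theorem PIso.adj {F : Set (V × V)} (hF : PIso R F) {p q : V × V} (hp : p ∈ F) (hq : q ∈ F) :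
    (UG R).Adj p.1 q.1 ↔ (UG R).Adj p.2 q.2 := by
  simp only [UG, SimpleGraph.fromRel_adj, ne_eq, (hF p hp q hq).1, (hF p hp q hq).2,
    (hF q hq p hp).2]

theorem PIso.near {F : Set (V × V)} (hF : PIso R F) {p q : V × V} (hp : p ∈ F) (hq : q ∈ F) :
    (p.1 = q.1 ∨ (UG R).Adj p.1 q.1) ↔ (p.2 = q.2 ∨ (UG R).Adj p.2 q.2) :=
  or_congr (hF p hp q hq).1 (hF.adj hp hq)

theorem PIso.mono {F F' : Set (V × V)} (hF : PIso R F') (h : F ⊆ F') : PIso R F :=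
  fun p hp q hq => hF p (h hp) q (h hq)

theorem PIso.eq_of_fst {F : Set (V × V)} (hF : PIso R F) {p q : V × V} (hp : p ∈ F) (hq : q ∈ F)
    (h : p.1 = q.1) : p = q :=
  Prod.ext h ((hF p hp q hq).1.1 h)

theorem PIso.eq_of_snd {F : Set (V × V)} (hF : PIso R F) {p q : V × V} (hp : p ∈ F) (hq : q ∈ F)
    (h : p.2 = q.2) : p = q :=
  Prod.ext ((hF p hp q hq).1.2 h) h

theorem PIso.joined_snd {F : Set (V × V)} (hF : PIso R F)
    (hc : ∀ x ∈ Prod.fst '' F, ∀ y ∈ Prod.fst '' F, Joined (UG R) (Prod.fst '' F) x y) :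
    ∀ x ∈ Prod.snd '' F, ∀ y ∈ Prod.snd '' F, Joined (UG R) (Prod.snd '' F) x y := by
  rintro _ ⟨p, hp, rfl⟩ _ ⟨q, hq, rfl⟩
  refine (hc _ (mem_image_of_mem _ hp) _ (mem_image_of_mem _ hq)).induct
    (P := fun u => ∀ r ∈ F, r.1 = u → Joined (UG R) (Prod.snd '' F) p.2 r.2) ?_ ?_ q hq rfl
  · intro r hr h
    rw [hF.eq_of_fst hr hp h]
    exact .refl (mem_image_of_mem _ hp)
  · rintro _ _ ⟨a, ha, rfl⟩ - hadj ih r hr rfl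
    exact (ih a ha rfl).trans (.of_adj (mem_image_of_mem _ ha) (mem_image_of_mem _ hr)
      ((hF.adj ha hr).1 hadj))

/-- The closed neighbourhood of `v`. -/
def cball (G : SimpleGraph V) (v : V) : Set V := {u | v = u ∨ G.Adj v u}

/-- Every partial isomorphism between the closed neighbourhoods of two vertices that touches
finitely many blocks, each of them completely or in a finite set, extends to the
neighbourhoods. -/
def LocalExt (R : V → V → Prop) : Prop :=
  ∀ (v w : V) (F T : Set (V × V)), PIso R F → (v, w) ∈ F → (∀ p ∈ F, p.1 ∈ cball (UG R) v) →
    T.Finite → T ⊆ F →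
    (∀ q ∈ F, (UG R).Adj v q.1 → ∃ r ∈ T, (UG R).Adj v r.1 ∧ (r.1 = q.1 ∨ (UG R).Adj r.1 q.1)) →
    (∀ q ∈ F, (UG R).Adj v q.1 →
      (line (UG R) v q.1 ⊆ Prod.fst '' F ∧ line (UG R) w q.2 ⊆ Prod.snd '' F) ∨
        {r ∈ F | r.1 ∈ line (UG R) v q.1}.Finite) →
    ∃ F', F ⊆ F' ∧ PIso R F' ∧ Prod.fst '' F' = cball (UG R) v ∧ Prod.snd '' F' = cball (UG R) w

theorem CliqueBlocks.line_subset_cball (hC : CliqueBlocks G) {v a b : V} (ha : a ∈ cball G v)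
    (hb : b ∈ cball G v) (hab : G.Adj a b) : line G a b ⊆ cball G v := fun _ hc =>
  hC.clique_line hab v ⟨ha, hb⟩ _ hc

/-- The neighbourhoods of `p.1` and `p.2` are contained in the domain and the range of `F`. -/
def Full (G : SimpleGraph V) (F : Set (V × V)) (p : V × V) : Prop :=
  cball G p.1 ⊆ Prod.fst '' F ∧ cball G p.2 ⊆ Prod.snd '' F

/-- The blocks through `p.1` and `q.1`, `p.2` and `q.2` are contained in the domain and the range
of `F`. -/
def BlockFull (G : SimpleGraph V) (F : Set (V × V)) (p q : V × V) : Prop :=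
  line G p.1 q.1 ⊆ Prod.fst '' F ∧ line G p.2 q.2 ⊆ Prod.snd '' F

/-- Partial isomorphisms arising from `F₀` by successively completing neighbourhoods. -/
structure Stage (R : V → V → Prop) (F₀ F : Set (V × V)) : Prop where
  base : F₀ ⊆ F
  pIso : PIso R F
  joined : ∀ x ∈ Prod.fst '' F, ∀ y ∈ Prod.fst '' F, Joined (UG R) (Prod.fst '' F) x y
  vertex : ∀ p ∈ F, Full (UG R) F p ∨
    (∀ q ∈ F, (UG R).Adj p.1 q.1 →
      ∃ r ∈ F₀, (UG R).Adj p.1 r.1 ∧ (r.1 = q.1 ∨ (UG R).Adj r.1 q.1)) ∨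
    ∀ q ∈ F, (UG R).Adj p.1 q.1 → ∀ r ∈ F, (UG R).Adj p.1 r.1 → r.1 = q.1 ∨ (UG R).Adj r.1 q.1
  block : ∀ p ∈ F, ∀ q ∈ F, (UG R).Adj p.1 q.1 → BlockFull (UG R) F p q ∨
    ∀ r ∈ F, r.1 ∈ line (UG R) p.1 q.1 → r ∈ F₀

theorem Full.mono {F F' : Set (V × V)} {p : V × V} (h : Full G F p) (hF : F ⊆ F') : Full G F' p :=
  ⟨h.1.trans (image_mono hF), h.2.trans (image_mono hF)⟩

theorem BlockFull.mono {F F' : Set (V × V)} {p q : V × V} (h : BlockFull G F p q) (hF : F ⊆ F') :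
    BlockFull G F' p q :=
  ⟨h.1.trans (image_mono hF), h.2.trans (image_mono hF)⟩

theorem Stage.sUnion {F₀ : Set (V × V)} {c : Set (Set (V × V))} (hc : ∀ F ∈ c, Stage R F₀ F)
    (hchain : IsChain (· ⊆ ·) c) (hne : c.Nonempty) : Stage R F₀ (⋃₀ c) := by
  have dir : ∀ F ∈ c, ∀ F' ∈ c, ∃ F'' ∈ c, F ⊆ F'' ∧ F' ⊆ F'' := fun F hF F' hF' =>
    hchain.directedOn F hF F' hF'
  have sub : ∀ F ∈ c, F ⊆ ⋃₀ c := fun F hF => subset_sUnion_of_mem hF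
  refine ⟨?_, ?_, ?_, ?_, ?_⟩
  · obtain ⟨F, hF⟩ := hne
    exact (hc F hF).base.trans (sub F hF)
  · rintro p ⟨F, hF, hp⟩ q ⟨F', hF', hq⟩
    obtain ⟨K, hK, h1, h2⟩ := dir F hF F' hF'
    exact (hc K hK).pIso p (h1 hp) q (h2 hq)
  · rintro _ ⟨p, ⟨F, hF, hp⟩, rfl⟩ _ ⟨q, ⟨F', hF', hq⟩, rfl⟩
    obtain ⟨K, hK, h1, h2⟩ := dir F hF F' hF'
    exact ((hc K hK).joined _ (mem_image_of_mem _ (h1 hp)) _ (mem_image_of_mem _ (h2 hq))).mono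
      (image_mono (sub K hK))
  · rintro p ⟨F, hF, hp⟩
    by_contra! ⟨hn, ⟨q, ⟨F₁, hF₁, hq⟩, hpq, hq'⟩, s, ⟨F₂, hF₂, hs⟩, hps, t, ⟨F₃, hF₃, ht⟩, hpt,
      hst⟩
    obtain ⟨K, hK, h1, h2⟩ := dir F hF F₁ hF₁
    obtain ⟨L, hL, h3, h4⟩ := dir F₂ hF₂ F₃ hF₃
    obtain ⟨M, hM, h5, h6⟩ := dir K hK L hL
    rcases (hc M hM).vertex p (h5 (h1 hp)) with h | h | h
    · exact hn (h.mono (sub M hM))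
    · obtain ⟨r, hr, hpr, hrq⟩ := h q (h5 (h2 hq)) hpq
      have := hq' r hr hpr
      tauto
    · have := h s (h6 (h3 hs)) hps t (h6 (h4 ht)) hpt
      tauto
  · rintro p ⟨F, hF, hp⟩ q ⟨F₁, hF₁, hq⟩ hpq
    by_contra! ⟨hn, r, ⟨F₂, hF₂, hr⟩, hr', hr''⟩
    obtain ⟨K, hK, h1, h2⟩ := dir F hF F₁ hF₁
    obtain ⟨M, hM, h3, h4⟩ := dir K hK F₂ hF₂
    rcases (hc M hM).block p (h3 (h1 hp)) q (h3 (h2 hq)) hpq with h | h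
    · exact hn (h.mono (sub M hM))
    · exact hr'' (h r (h4 hr) hr')

theorem near_symm {a b : V} (h : a = b ∨ G.Adj a b) : b = a ∨ G.Adj b a :=
  h.imp Eq.symm SimpleGraph.Adj.symm

/-- A vertex of a connected set `A` that is adjacent to a vertex outside `A` in the closed
neighbourhood of `v ∈ A` lies in this neighbourhood. -/
theorem CliqueBlocks.mem_cball (hC : CliqueBlocks G) {A : Set V} {v x y : V}
    (hA : ∀ y ∈ A, ∀ z ∈ A, Joined G A y z) (hv : v ∈ A) (hx : x ∈ A) (hy : y ∉ A)
    (hvy : y ∈ cball G v) (hxy : G.Adj x y) : x ∈ cball G v := by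
  rcases hvy with rfl | hvy
  · exact absurd hv hy
  · exact hC.of_set hy hA hv hx hvy.symm hxy.symm

/-- Gluing a star isomorphism to a partial isomorphism with connected domain. -/
theorem PIso.union_star (hC : CliqueBlocks (UG R)) (hR : ∀ x, ¬ R x x) {F F' : Set (V × V)}
    (hF : PIso R F)
    (hc : ∀ x ∈ Prod.fst '' F, ∀ y ∈ Prod.fst '' F, Joined (UG R) (Prod.fst '' F) x y)
    {p : V × V} (hp : p ∈ F) (hF' : PIso R F') (h₁ : Prod.fst '' F' = cball (UG R) p.1)
    (h₂ : Prod.snd '' F' = cball (UG R) p.2)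
    (hsub : ∀ q ∈ F, q.1 ∈ cball (UG R) p.1 → q ∈ F') : PIso R (F ∪ F') := by
  have hsub' : ∀ q ∈ F, q.2 ∈ cball (UG R) p.2 → q ∈ F' := fun q hq h =>
    hsub q hq ((hF.near hp hq).2 h)
  have m1 : ∀ q ∈ F', q.1 ∈ cball (UG R) p.1 := fun q hq => h₁ ▸ mem_image_of_mem _ hq
  have m2 : ∀ q ∈ F', q.2 ∈ cball (UG R) p.2 := fun q hq => h₂ ▸ mem_image_of_mem _ hq
  have key : ∀ a ∈ F, ∀ b ∈ F', ((a.1 = b.1 ↔ a.2 = b.2) ∧ (R a.1 b.1 ↔ R a.2 b.2) ∧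
      (R b.1 a.1 ↔ R b.2 a.2)) := by
    intro a ha b hb
    by_cases hb' : b ∈ F
    · exact ⟨(hF a ha b hb').1, (hF a ha b hb').2, (hF b hb' a ha).2⟩
    by_cases ha' : a ∈ F'
    · exact ⟨(hF' a ha' b hb).1, (hF' a ha' b hb).2, (hF' b hb a ha').2⟩
    have n1 : a.1 ∉ cball (UG R) p.1 := fun h => ha' (hsub a ha h)
    have n2 : a.2 ∉ cball (UG R) p.2 := fun h => ha' (hsub' a ha h)
    have b1 : b.1 ∉ Prod.fst '' F := by
      rintro ⟨c, hc, h⟩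
      have hcF' := hsub c hc (h ▸ m1 b hb)
      exact hb' (hF'.eq_of_fst hcF' hb h ▸ hc)
    have b2 : b.2 ∉ Prod.snd '' F := by
      rintro ⟨c, hc, h⟩
      have hcF' := hsub' c hc (h ▸ m2 b hb)
      exact hb' (hF'.eq_of_snd hcF' hb h ▸ hc)
    have e1 : a.1 ≠ b.1 := fun h => n1 (h ▸ m1 b hb)
    have e2 : a.2 ≠ b.2 := fun h => n2 (h ▸ m2 b hb)
    have a1 : ¬ (UG R).Adj a.1 b.1 := fun h => n1 (hC.mem_cball hc (mem_image_of_mem _ hp)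
      (mem_image_of_mem _ ha) b1 (m1 b hb) h)
    have a2 : ¬ (UG R).Adj a.2 b.2 := fun h => n2 (hC.mem_cball (hF.joined_snd hc)
      (mem_image_of_mem _ hp) (mem_image_of_mem _ ha) b2 (m2 b hb) h)
    rw [UG_adj_iff hR] at a1 a2
    tauto
  rintro a (ha | ha) b (hb | hb)
  · exact hF a ha b hb
  · exact ⟨(key a ha b hb).1, (key a ha b hb).2.1⟩
  · have := key b hb a ha
    exact ⟨by rw [eq_comm, this.1, eq_comm], this.2.2⟩
  · exact hF' a ha b hb

theorem Stage.step (hC : CliqueBlocks (UG R)) (hR : ∀ x, ¬ R x x) (hloc : LocalExt R)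
    {F₀ F : Set (V × V)} (hfin : F₀.Finite) (hF : Stage R F₀ F) {p : V × V} (hp : p ∈ F) :
    ∃ F', F ⊆ F' ∧ Stage R F₀ F' ∧ Full (UG R) F' p := by
  by_cases hfull : Full (UG R) F p
  · exact ⟨F, Subset.rfl, hF, hfull⟩
  have hpp : p.1 ∈ cball (UG R) p.1 := Or.inl rfl
  have hsep : ∃ T : Set (V × V), T.Finite ∧ T ⊆ {q ∈ F | q.1 ∈ cball (UG R) p.1} ∧
      ∀ q ∈ {q ∈ F | q.1 ∈ cball (UG R) p.1}, (UG R).Adj p.1 q.1 →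
        ∃ r ∈ T, (UG R).Adj p.1 r.1 ∧ (r.1 = q.1 ∨ (UG R).Adj r.1 q.1) := by
    rcases (hF.vertex p hp).resolve_left hfull with h | h
    · refine ⟨{q ∈ F₀ | q.1 ∈ cball (UG R) p.1}, hfin.subset (sep_subset _ _),
        fun q hq => ⟨hF.base hq.1, hq.2⟩, fun q hq hpq => ?_⟩
      obtain ⟨r, hr, hpr, hrq⟩ := h q hq.1 hpq
      exact ⟨r, ⟨hr, Or.inr hpr⟩, hpr, hrq⟩
    · by_cases hex : ∃ r ∈ F, (UG R).Adj p.1 r.1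
      · obtain ⟨r, hr, hpr⟩ := hex
        exact ⟨{r}, finite_singleton r, singleton_subset_iff.2 ⟨hr, Or.inr hpr⟩,
          fun q hq hpq => ⟨r, rfl, hpr, h q hq.1 hpq r hr hpr⟩⟩
      · push Not at hex
        exact ⟨∅, finite_empty, empty_subset _, fun q hq hpq => absurd hpq (hex q hq.1)⟩
  obtain ⟨T, hT, hTF, hT'⟩ := hsep
  obtain ⟨F', hFF', hF', h₁, h₂⟩ := hloc p.1 p.2 {q ∈ F | q.1 ∈ cball (UG R) p.1} T
    (hF.pIso.mono (sep_subset _ _)) ⟨hp, hpp⟩ (fun q hq => hq.2) hT hTF hT' (by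
      rintro q ⟨hq, hq'⟩ hpq
      rcases hF.block p hp q hq hpq with h | h
      · left
        constructor
        · intro x hx
          obtain ⟨r, hr, rfl⟩ := h.1 hx
          exact ⟨r, ⟨hr, hC.line_subset_cball hpp hq' hpq hx⟩, rfl⟩
        · intro x hx
          obtain ⟨r, hr, rfl⟩ := h.2 hx
          refine ⟨r, ⟨hr, (hF.pIso.near hp hr).2 ?_⟩, rfl⟩
          exact near_symm hx.1
      · right
        exact hfin.subset fun r hr => h r hr.1.1 hr.2)
  have hsub : ∀ q ∈ F, q.1 ∈ cball (UG R) p.1 → q ∈ F' := fun q hq h => hFF' ⟨hq, h⟩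
  have hun := hF.pIso.union_star hC hR hF.joined hp hF' h₁ h₂ hsub
  have m1 : ∀ q ∈ F', q.1 ∈ cball (UG R) p.1 := fun q hq => h₁ ▸ mem_image_of_mem _ hq
  have new : ∀ q ∈ F', q ∉ F → q.1 ∉ Prod.fst '' F := by
    rintro q hq hq' ⟨r, hr, h⟩
    exact hq' (hF'.eq_of_fst (hsub r hr (h ▸ m1 q hq)) hq h ▸ hr)
  have near : ∀ a ∈ F, ∀ q ∈ F', q ∉ F → (UG R).Adj a.1 q.1 → a.1 ∈ cball (UG R) p.1 :=
    fun a ha q hq hq' h => hC.mem_cball hF.joined (mem_image_of_mem _ hp) (mem_image_of_mem _ ha)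
      (new q hq hq') (m1 q hq) h
  have hp' : Full (UG R) (F ∪ F') p :=
    ⟨h₁ ▸ image_mono subset_union_right, h₂ ▸ image_mono subset_union_right⟩
  refine ⟨F ∪ F', subset_union_left, ⟨hF.base.trans subset_union_left, hun, ?_, ?_, ?_⟩, hp'⟩
  · have hmem : p.1 ∈ Prod.fst '' (F ∪ F') := ⟨p, Or.inl hp, rfl⟩
    have : ∀ x ∈ Prod.fst '' (F ∪ F'), Joined (UG R) (Prod.fst '' (F ∪ F')) p.1 x := by
      rintro _ ⟨q, hq, rfl⟩
      rcases id hq with hq' | hq'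
      · exact (hF.joined _ (mem_image_of_mem _ hp) _ (mem_image_of_mem _ hq')).mono
          (image_mono subset_union_left)
      · rcases m1 q hq' with h | h
        · rw [← h]
          exact .refl hmem
        · exact .of_adj hmem ⟨q, hq, rfl⟩ h
    exact fun x hx y hy => (this x hx).symm.trans (this y hy)
  · intro a ha
    by_cases haF : a ∈ F
    · by_cases hap : a.1 = p.1
      · left
        rwa [hF.pIso.eq_of_fst haF hp hap]
      have hrep : ∀ q ∈ F ∪ F', (UG R).Adj a.1 q.1 →
          ∃ r ∈ F, (UG R).Adj a.1 r.1 ∧ (r.1 = q.1 ∨ (UG R).Adj r.1 q.1) := by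
        intro q hq haq
        by_cases hqF : q ∈ F
        · exact ⟨q, hqF, haq, Or.inl rfl⟩
        have hq' := hq.resolve_left hqF
        refine ⟨p, hp, ?_, m1 q hq'⟩
        exact ((near a haF q hq' hqF haq).resolve_left (Ne.symm hap)).symm
      rcases hF.vertex a haF with h | h | h
      · exact Or.inl (h.mono subset_union_left)
      · right; left
        intro q hq haq
        obtain ⟨r, hr, har, hrq⟩ := hrep q hq haq
        obtain ⟨s, hs, has, hsr⟩ := h r hr har
        exact ⟨s, hs, has, hC.trans has har haq hsr hrq⟩
      · right; right
        intro q hq haq q' hq' haq'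
        obtain ⟨r, hr, har, hrq⟩ := hrep q hq haq
        obtain ⟨r', hr', har', hrq'⟩ := hrep q' hq' haq'
        exact hC.trans haq' har haq (hC.trans haq' har' har (near_symm hrq') (h r hr har r' hr' har'))
          hrq
    · right; right
      have haF' := ha.resolve_left haF
      have hpa : (UG R).Adj p.1 a.1 := by
        rcases m1 a haF' with h | h
        · exact absurd ⟨p, hp, h⟩ (new a haF' haF)
        · exact h
      have hall : ∀ q ∈ F ∪ F', (UG R).Adj a.1 q.1 → q.1 ∈ cball (UG R) p.1 := by
        intro q hq haq
        rcases hq with hq | hq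
        · exact near q hq a haF' haF haq.symm
        · exact m1 q hq
      intro q hq haq q' hq' haq'
      exact hC.trans haq' hpa.symm haq (near_symm (hall q' hq' haq')) (hall q hq haq)
  · have hstar : ∀ a ∈ F ∪ F', ∀ b ∈ F ∪ F', (UG R).Adj a.1 b.1 → a.1 ∈ cball (UG R) p.1 →
        b.1 ∈ cball (UG R) p.1 → BlockFull (UG R) (F ∪ F') a b := by
      intro a ha b hb hab ha' hb'
      exact ⟨(hC.line_subset_cball ha' hb' hab).trans hp'.1,
        (hC.line_subset_cball ((hun.near (Or.inl hp) ha).1 ha')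
          ((hun.near (Or.inl hp) hb).1 hb') ((hun.adj ha hb).1 hab)).trans hp'.2⟩
    intro a ha b hb hab
    by_cases hst : a.1 ∈ cball (UG R) p.1 ∧ b.1 ∈ cball (UG R) p.1
    · exact Or.inl (hstar a ha b hb hab hst.1 hst.2)
    have haF : a ∈ F := by
      by_contra haF
      have haF' := ha.resolve_left haF
      refine hst ⟨m1 a haF', ?_⟩
      rcases hb with hb | hb
      · exact near b hb a haF' haF hab.symm
      · exact m1 b hb
    have hbF : b ∈ F := by
      by_contra hbF
      have hbF' := hb.resolve_left hbF
      exact hst ⟨near a haF b hbF' hbF hab, m1 b hbF'⟩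
    rcases hF.block a haF b hbF hab with h | h
    · exact Or.inl (h.mono subset_union_left)
    · right
      intro r hr hrl
      by_cases hrF : r ∈ F
      · exact h r hrF hrl
      have hrF' := hr.resolve_left hrF
      have hnew := new r hrF' hrF
      refine absurd ⟨?_, ?_⟩ hst
      · rcases hrl.1 with h | h
        · exact absurd ⟨a, haF, h.symm⟩ hnew
        · exact near a haF r hrF' hrF h.symm
      · rcases hrl.2 with h | h
        · exact absurd ⟨b, hbF, h.symm⟩ hnew
        · exact near b hbF r hrF' hrF h.symm

theorem eq_univ_of_cball_subset (hconn : G.Connected) {A : Set V} (hne : A.Nonempty)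
    (h : ∀ a ∈ A, cball G a ⊆ A) : A = univ := by
  obtain ⟨a, ha⟩ := hne
  exact eq_univ_of_forall fun x => (joined_univ hconn a x).induct (P := (· ∈ A)) ha
    fun u v _ _ huv hu => h u hu (Or.inr huv)

/-- Local extendability of partial isomorphisms implies C-homogeneity. -/
theorem LocalExt.digraphCHom (hloc : LocalExt R) (hR : ∀ x, ¬ R x x) (hconn : (UG R).Connected)
    (hC : CliqueBlocks (UG R)) : DigraphCHom R := by
  intro X Y hX hY hXc φ hφ
  let F₀ : Set (V × V) := range fun a : X => (a.1, (φ a).1)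
  have hfst : Prod.fst '' F₀ = X := by
    rw [← range_comp]
    exact Subtype.range_coe
  have hfin : F₀.Finite := by
    have := hX.to_subtype
    exact finite_range _
  rw [connected_iff] at hXc
  have h₀ : Stage R F₀ F₀ := by
    refine ⟨Subset.rfl, ?_, ?_, ?_, ?_⟩
    · rintro _ ⟨a, rfl⟩ _ ⟨b, rfl⟩
      refine ⟨?_, hφ a b⟩
      simp only [← Subtype.ext_iff, φ.injective.eq_iff]
    · rw [hfst]
      exact hXc.2
    · exact fun p _ => Or.inr (Or.inl fun q hq hpq => ⟨q, hq, hpq, Or.inl rfl⟩)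
    · exact fun p _ q _ _ => Or.inr fun r hr _ => hr
  obtain ⟨F, hF₀, hmax⟩ := zorn_subset_nonempty {F | Stage R F₀ F}
    (fun c hc hchain hne => ⟨⋃₀ c, Stage.sUnion hc hchain hne, fun s => subset_sUnion_of_mem⟩)
    F₀ h₀
  have hF : Stage R F₀ F := hmax.prop
  have hfull : ∀ p ∈ F, Full (UG R) F p := by
    intro p hp
    obtain ⟨F', hsub, hF', hp'⟩ := hF.step hC hR hloc hfin hp
    rwa [hmax.eq_of_subset hF' hsub]
  obtain ⟨x, hx⟩ := hXc.1
  have hxF : (x, (φ ⟨x, hx⟩).1) ∈ F := hF₀ ⟨⟨x, hx⟩, rfl⟩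
  have hdom : Prod.fst '' F = univ := eq_univ_of_cball_subset hconn ⟨_, _, hxF, rfl⟩ (by
    rintro _ ⟨p, hp, rfl⟩
    exact (hfull p hp).1)
  have hran : Prod.snd '' F = univ := eq_univ_of_cball_subset hconn ⟨_, _, hxF, rfl⟩ (by
    rintro _ ⟨p, hp, rfl⟩
    exact (hfull p hp).2)
  have hex : ∀ x, ∃ y, (x, y) ∈ F := fun x => by
    obtain ⟨p, hp, rfl⟩ := hdom.symm ▸ mem_univ x
    exact ⟨p.2, hp⟩
  choose f hf using hex
  have hbij : Function.Bijective f := by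
    refine ⟨fun x y h => (hF.pIso _ (hf x) _ (hf y)).1.2 h, fun y => ?_⟩
    obtain ⟨p, hp, rfl⟩ := hran.symm ▸ mem_univ y
    exact ⟨p.1, ((hF.pIso _ (hf p.1) _ hp).1.1 rfl)⟩
  refine ⟨Equiv.ofBijective f hbij, fun x y => (hF.pIso _ (hf x) _ (hf y)).2.symm, fun a => ?_⟩
  exact (hF.pIso _ (hf a.1) _ (hF₀ ⟨a, rfl⟩)).1.1 rfl

end Extension

end CHom

namespace CHom

/-- A finite partial bijection that respects the fibres of two functions with equinumerous fibres
extends to a bijection that respects the fibres. -/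
theorem exists_equiv_extending {α β γ : Type*} {f : α → γ} {g : β → γ}
    (h : ∀ c, Nonempty ({a // f a = c} ≃ {b // g b = c})) {S : Set (α × β)} (hS : S.Finite)
    (hbij : ∀ p ∈ S, ∀ q ∈ S, p.1 = q.1 ↔ p.2 = q.2) (hfg : ∀ p ∈ S, f p.1 = g p.2) :
    ∃ Φ : α ≃ β, (∀ p ∈ S, Φ p.1 = p.2) ∧ ∀ a, g (Φ a) = f a := by
  classical
  induction S, hS using Set.Finite.induction_on with
  | empty =>
    exact ⟨Equiv.ofFiberEquiv fun c => (h c).some, fun p hp => absurd hp (notMem_empty p),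
      Equiv.ofFiberEquiv_map _⟩
  | @insert p S _ _ ih =>
    obtain ⟨Φ, hΦ, hΦ'⟩ := ih
      (fun a ha b hb => hbij a (mem_insert_of_mem _ ha) b (mem_insert_of_mem _ hb))
      (fun a ha => hfg a (mem_insert_of_mem _ ha))
    have hp := hfg p (mem_insert _ _)
    refine ⟨Φ.trans (Equiv.swap (Φ p.1) p.2), ?_, fun a => ?_⟩
    · rintro q (rfl | hq)
      · simp
      · have := hbij q (mem_insert_of_mem _ hq) p (mem_insert _ _)
        rw [Equiv.trans_apply, hΦ q hq]
        by_cases hqp : q.1 = p.1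
        · rw [← this.1 hqp, ← hqp, hΦ q hq, Equiv.swap_self, Equiv.refl_apply]
        · refine Equiv.swap_apply_of_ne_of_ne (fun h => hqp ?_) (fun h => hqp (this.2 h))
          rw [← hΦ q hq] at h
          exact Φ.injective h
    · rw [Equiv.trans_apply, ← hΦ' a]
      by_cases h1 : Φ a = Φ p.1
      · rw [h1, Equiv.swap_apply_left, ← hp, hΦ']
      by_cases h2 : Φ a = p.2
      · rw [h2, Equiv.swap_apply_right, hΦ', hp]
      · rw [Equiv.swap_apply_of_ne_of_ne h1 h2]

section Local

variable {V : Type u} {R : V → V → Prop} {G : SimpleGraph V}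

/-- The lines through `v`. -/
def linesAt (G : SimpleGraph V) (v : V) : Set (Set V) := {B | ∃ u, G.Adj v u ∧ B = line G v u}

theorem CliqueBlocks.line_eq_line_iff (hC : CliqueBlocks G) {v a b : V} (ha : G.Adj v a)
    (hb : G.Adj v b) : line G v a = line G v b ↔ a = b ∨ G.Adj a b := by
  constructor
  · intro h
    have : a ∈ line G v b := h ▸ right_mem_line ha
    exact this.2
  · intro h
    exact hC.line_eq hb (left_mem_line hb) ⟨Or.inr ha.symm, h⟩ ha.ne

theorem CliqueBlocks.line_eq_of_mem (hC : CliqueBlocks G) {v u : V} {B : Set V}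
    (hB : B ∈ linesAt G v) (hu : u ∈ B) (huv : v ≠ u) : G.Adj v u ∧ line G v u = B := by
  obtain ⟨w, hvw, rfl⟩ := hB
  exact ⟨((hC.clique_line hvw) v (left_mem_line hvw) u hu).resolve_left huv,
    hC.line_eq hvw (left_mem_line hvw) hu huv⟩

theorem mem_of_mem_linesAt {v : V} {B : Set V} (hB : B ∈ linesAt G v) : v ∈ B := by
  obtain ⟨w, hvw, rfl⟩ := hB
  exact left_mem_line hvw

theorem line_mem_linesAt {v u : V} (h : G.Adj v u) : line G v u ∈ linesAt G v := ⟨u, h, rfl⟩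

theorem subset_cball_of_mem_linesAt {v : V} {B : Set V} (hB : B ∈ linesAt G v) :
    B ⊆ cball G v := by
  obtain ⟨w, hvw, rfl⟩ := hB
  exact fun x hx => near_symm hx.1

/-- Every finite partial isomorphism from `B` to `B'` mapping `v` to `w` extends to an
isomorphism. -/
def BlockExt (R : V → V → Prop) (v w : V) (B B' : Set V) : Prop :=
  ∀ F : Set (V × V), PIso R F → F.Finite → (v, w) ∈ F → (∀ p ∈ F, p.1 ∈ B ∧ p.2 ∈ B') →
    ∃ F', F ⊆ F' ∧ PIso R F' ∧ Prod.fst '' F' = B ∧ Prod.snd '' F' = B'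

theorem localExt_of (hC : CliqueBlocks (UG R)) (hR : ∀ x, ¬ R x x) (τ : V → Set V → Prop)
    (hτ : ∀ v w v' w', (UG R).Adj v v' → (UG R).Adj w w' → (R v v' ↔ R w w') →
      (R v' v ↔ R w' w) → (τ v (line (UG R) v v') = τ w (line (UG R) w w')))
    (hblock : ∀ v w, ∀ B ∈ linesAt (UG R) v, ∀ B' ∈ linesAt (UG R) w, τ v B = τ w B' →
      BlockExt R v w B B')
    (hcount : ∀ v w (c : Prop), Nonempty ({B : linesAt (UG R) v // τ v B = c} ≃
      {B : linesAt (UG R) w // τ w B = c})) : LocalExt R := by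
  intro v w F T hF hvw hFv hT hTF hTF' hfin
  have hFw : ∀ p ∈ F, p.2 ∈ cball (UG R) w := fun p hp => (hF.near hvw hp).1 (hFv p hp)
  let S : Set (linesAt (UG R) v × linesAt (UG R) w) :=
    {s | ∃ q ∈ T, (UG R).Adj v q.1 ∧ s.1.1 = line (UG R) v q.1 ∧ s.2.1 = line (UG R) w q.2}
  have hSfin : S.Finite := by
    refine Set.Finite.of_finite_image (f := fun s => (s.1.1, s.2.1)) (((hT.image fun q =>
      (line (UG R) v q.1, line (UG R) w q.2))).subset ?_) ?_
    · rintro _ ⟨s, ⟨q, hq, -, h1, h2⟩, rfl⟩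
      exact ⟨q, hq, by simp only [h1, h2]⟩
    · rintro ⟨a, b⟩ - ⟨c, d⟩ - h
      simp only [Prod.mk.injEq] at h
      exact Prod.ext (Subtype.ext h.1) (Subtype.ext h.2)
  obtain ⟨Φ, hΦ, hΦτ⟩ := exists_equiv_extending (f := fun B : linesAt (UG R) v => τ v B)
    (g := fun B : linesAt (UG R) w => τ w B) (hcount v w) hSfin
    (by
      rintro ⟨a, b⟩ ⟨q, hq, hvq, h1, h2⟩ ⟨a', b'⟩ ⟨q', hq', hvq', h1', h2'⟩
      simp only at h1 h2 h1' h2'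
      simp only [Subtype.ext_iff, h1, h2, h1', h2']
      rw [hC.line_eq_line_iff hvq hvq', hC.line_eq_line_iff ((hF.adj hvw (hTF hq)).1 hvq)
        ((hF.adj hvw (hTF hq')).1 hvq')]
      exact hF.near (hTF hq) (hTF hq'))
    (by
      rintro ⟨a, b⟩ ⟨q, hq, hvq, h1, h2⟩
      simp only at h1 h2
      simp only [h1, h2]
      exact hτ _ _ _ _ hvq ((hF.adj hvw (hTF hq)).1 hvq) (hF _ hvw _ (hTF hq)).2
        (hF _ (hTF hq) _ hvw).2)
  have hΦF : ∀ q ∈ F, ∀ h : (UG R).Adj v q.1, (Φ ⟨_, line_mem_linesAt h⟩).1 = line (UG R) w q.2 := by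
    intro q hq hvq
    obtain ⟨r, hr, hvr, hrq⟩ := hTF' q hq hvq
    have hwr := (hF.adj hvw (hTF hr)).1 hvr
    have hwq := (hF.adj hvw hq).1 hvq
    have h1 := (hC.line_eq_line_iff hvr hvq).2 hrq
    have h2 := (hC.line_eq_line_iff hwr hwq).2 ((hF.near (hTF hr) hq).1 hrq)
    have := hΦ (⟨_, line_mem_linesAt hvq⟩, ⟨_, line_mem_linesAt hwq⟩)
      ⟨r, hr, hvr, h1.symm, h2.symm⟩
    exact congrArg Subtype.val this
  have hmem : ∀ B : linesAt (UG R) v, ∀ q ∈ F, q.1 ∈ B.1 → q.2 ∈ (Φ B).1 := by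
    intro B q hq hqB
    by_cases hqv : v = q.1
    · rw [← hF.eq_of_fst hvw hq hqv]
      exact mem_of_mem_linesAt (Φ B).2
    · obtain ⟨hvq, hB⟩ := hC.line_eq_of_mem B.2 hqB hqv
      have : B = ⟨_, line_mem_linesAt hvq⟩ := Subtype.ext hB.symm
      rw [this, hΦF q hq hvq]
      exact right_mem_line ((hF.adj hvw hq).1 hvq)
  have hex : ∀ B : linesAt (UG R) v, ∃ K, {q ∈ F | q.1 ∈ B.1} ⊆ K ∧ PIso R K ∧
      Prod.fst '' K = B.1 ∧ Prod.snd '' K = (Φ B).1 := by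
    intro B
    have hP := hF.mono (sep_subset F fun q => q.1 ∈ B.1)
    by_cases hBfin : {q ∈ F | q.1 ∈ B.1}.Finite
    · exact hblock v w B.1 B.2 _ (Φ B).2 (hΦτ B).symm _ hP hBfin
        ⟨hvw, mem_of_mem_linesAt B.2⟩ fun p hp => ⟨hp.2, hmem B p hp.1 hp.2⟩
    · obtain ⟨q, ⟨hq, hqB⟩, hqv⟩ : ∃ q ∈ {q ∈ F | q.1 ∈ B.1}, v ≠ q.1 := by
        by_contra! h
        exact hBfin ((finite_singleton (v, w)).subset fun q hq =>
          (hF.eq_of_fst hvw hq.1 (h q hq)).symm)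
      obtain ⟨hvq, hB⟩ := hC.line_eq_of_mem B.2 hqB hqv
      have hB' : B = ⟨_, line_mem_linesAt hvq⟩ := Subtype.ext hB.symm
      have hΦB : (Φ B).1 = line (UG R) w q.2 := by rw [hB', hΦF q hq hvq]
      rcases hfin q hq hvq with h | h
      · refine ⟨_, Subset.rfl, hP, Subset.antisymm ?_ ?_, Subset.antisymm ?_ ?_⟩
        · rintro _ ⟨r, hr, rfl⟩
          exact hr.2
        · intro x hx
          obtain ⟨r, hr, rfl⟩ := h.1 (hB.symm ▸ hx)
          exact ⟨r, ⟨hr, hx⟩, rfl⟩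
        · rintro _ ⟨r, hr, rfl⟩
          exact hmem B r hr.1 hr.2
        · intro x hx
          rw [hΦB] at hx
          obtain ⟨r, hr, rfl⟩ := h.2 hx
          refine ⟨r, ⟨hr, ?_⟩, rfl⟩
          rw [← hB]
          exact ⟨near_symm ((hF.near hvw hr).2 (near_symm hx.1)), (hF.near hr hq).2 hx.2⟩
      · rw [hB] at h
        exact absurd h hBfin
  choose K hFK hK hK1 hK2 using hex
  have hvwK : ∀ B, (v, w) ∈ K B := fun B => hFK B ⟨hvw, mem_of_mem_linesAt B.2⟩
  have k1 : ∀ {B q}, q ∈ K B → q.1 ∈ B.1 := fun {B q} hq => hK1 B ▸ mem_image_of_mem _ hq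
  have k2 : ∀ {B q}, q ∈ K B → q.2 ∈ (Φ B).1 := fun {B q} hq => hK2 B ▸ mem_image_of_mem _ hq
  refine ⟨insert (v, w) (⋃ B, K B), ?_, ?_, ?_, ?_⟩
  · intro q hq
    rcases hFv q hq with h | h
    · exact Or.inl (hF.eq_of_fst hvw hq h).symm
    · exact Or.inr (mem_iUnion.2 ⟨⟨_, line_mem_linesAt h⟩, hFK _ ⟨hq, right_mem_line h⟩⟩)
  · have hKK : ∀ B B' : linesAt (UG R) v, ∀ p ∈ K B, ∀ q ∈ K B',
        (p.1 = q.1 ↔ p.2 = q.2) ∧ (R p.1 q.1 ↔ R p.2 q.2) := by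
      intro B B' p hp q hq
      by_cases hBB : B = B'
      · subst hBB
        exact hK B p hp q hq
      by_cases hpv : v = p.1
      · rw [← (hK B).eq_of_fst (hvwK B) hp hpv]
        exact hK B' _ (hvwK B') q hq
      by_cases hqv : v = q.1
      · rw [← (hK B').eq_of_fst (hvwK B') hq hqv]
        exact hK B p hp _ (hvwK B)
      have hpw : w ≠ p.2 := fun h => hpv ((hK B _ (hvwK B) p hp).1.2 h)
      have hqw : w ≠ q.2 := fun h => hqv ((hK B' _ (hvwK B') q hq).1.2 h)
      obtain ⟨hvp, e1⟩ := hC.line_eq_of_mem B.2 (k1 hp) hpv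
      obtain ⟨hvq, e2⟩ := hC.line_eq_of_mem B'.2 (k1 hq) hqv
      obtain ⟨hwp, e3⟩ := hC.line_eq_of_mem (Φ B).2 (k2 hp) hpw
      obtain ⟨hwq, e4⟩ := hC.line_eq_of_mem (Φ B').2 (k2 hq) hqw
      have n1 := mt (hC.line_eq_line_iff hvp hvq).2 (by
        rw [e1, e2]
        exact fun h => hBB (Subtype.ext h))
      have n2 := mt (hC.line_eq_line_iff hwp hwq).2 (by
        rw [e3, e4]
        exact fun h => hBB (Φ.injective (Subtype.ext h)))
      rw [UG_adj_iff hR] at n1 n2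
      tauto
    rintro p hp q hq
    rw [mem_insert_iff, mem_iUnion] at hp hq
    rcases hp with rfl | ⟨B, hp⟩ <;> rcases hq with rfl | ⟨B', hq⟩
    · exact hF _ hvw _ hvw
    · exact hK B' _ (hvwK B') q hq
    · exact hK B p hp _ (hvwK B)
    · exact hKK B B' p hp q hq
  · rw [image_insert_eq, image_iUnion]
    simp only [hK1]
    refine Subset.antisymm (insert_subset (Or.inl rfl)
      (iUnion_subset fun B => subset_cball_of_mem_linesAt B.2)) ?_
    rintro x (rfl | hx)
    · exact mem_insert _ _
    · exact Or.inr (mem_iUnion.2 ⟨⟨_, line_mem_linesAt hx⟩, right_mem_line hx⟩)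
  · rw [image_insert_eq, image_iUnion]
    simp only [hK2]
    refine Subset.antisymm (insert_subset (Or.inl rfl)
      (iUnion_subset fun B => subset_cball_of_mem_linesAt (Φ B).2)) ?_
    rintro x (rfl | hx)
    · exact mem_insert _ _
    · refine Or.inr (mem_iUnion.2 ⟨Φ.symm ⟨_, line_mem_linesAt hx⟩, ?_⟩)
      rw [Equiv.apply_symm_apply]
      exact right_mem_line hx

end Local

end CHom

namespace CHom

section Tree

variable {V : Type u} {R : V → V → Prop} {G : SimpleGraph V}

theorem eq_of_joined_of_isTree (hT : G.IsTree) {x y z : V} (hxy : G.Adj x y) (hxz : G.Adj x z)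
    (h : Joined G {x}ᶜ y z) : y = z := by
  by_contra hne
  have hb := SimpleGraph.isAcyclic_iff_forall_adj_isBridge.1 hT.2 hxy
  rw [SimpleGraph.isBridge_iff] at hb
  refine hb ?_
  have hyz : (G.deleteEdges {s(x, y)}).Reachable y z := by
    refine h.induct (P := fun u => (G.deleteEdges {s(x, y)}).Reachable y u) (.refl _) ?_
    intro u v hu hv huv ih
    refine ih.trans (SimpleGraph.Adj.reachable ?_)
    rw [SimpleGraph.deleteEdges_adj]
    refine ⟨huv, fun h => ?_⟩
    rw [mem_singleton_iff, Sym2.eq_iff] at h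
    rcases h with h | h
    · exact hu h.1
    · exact hv h.2
  refine (SimpleGraph.Adj.reachable ?_).trans hyz.symm
  rw [SimpleGraph.deleteEdges_adj]
  refine ⟨hxz, fun h => ?_⟩
  rw [mem_singleton_iff, Sym2.eq_iff] at h
  rcases h with h | h
  · exact hne h.2.symm
  · exact hxy.ne h.1

theorem cliqueBlocks_of_isTree (hT : G.IsTree) : CliqueBlocks G := fun _ _ _ hxy hxz h =>
  Or.inl (eq_of_joined_of_isTree hT hxy hxz h)

theorem not_adj_of_isTree (hT : G.IsTree) {x y z : V} (hxy : G.Adj x y) (hxz : G.Adj x z) :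
    ¬ G.Adj y z := fun h =>
  h.ne (eq_of_joined_of_isTree hT hxy hxz (.of_adj hxy.ne' hxz.ne' h))

theorem line_eq_pair (hT : G.IsTree) {u v : V} (huv : G.Adj u v) : line G u v = {u, v} := by
  ext w
  constructor
  · rintro ⟨rfl | h1, h2⟩
    · exact Or.inl rfl
    · rcases h2 with rfl | h2
      · exact Or.inr rfl
      · exact absurd huv (not_adj_of_isTree hT h1 h2)
  · rintro (rfl | rfl)
    exacts [left_mem_line huv, right_mem_line huv]

/-- A tree-like relation in which all vertices have the same numbers of neighbours of each kind
is C-homogeneous. -/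
theorem digraphCHom_of_isTree (hR : ∀ x, ¬ R x x) (hT : (UG R).IsTree)
    (hflip : ∀ v w v' w', (UG R).Adj v v' → (UG R).Adj w w' → (R v v' ↔ R w w') →
      (R v' v ↔ R w' w))
    (hcount : ∀ v w (c : Prop), Nonempty ({u // (UG R).Adj v u ∧ R v u = c} ≃
      {u // (UG R).Adj w u ∧ R w u = c})) : DigraphCHom R := by
  have hC := cliqueBlocks_of_isTree hT
  have hτ : ∀ {v u}, (UG R).Adj v u → (∃ x ∈ line (UG R) v u, R v x) = R v u := by
    intro v u huv
    rw [line_eq_pair hT huv]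
    simp [hR]
  refine (localExt_of hC hR (fun v B => ∃ x ∈ B, R v x) ?_ ?_ ?_).digraphCHom hR hT.1 hC
  · intro v w v' w' hv hw h _
    rw [hτ hv, hτ hw, h]
  · rintro v w _ ⟨u, hvu, rfl⟩ _ ⟨u', hwu, rfl⟩ h F hF - hvw hsub
    rw [hτ hvu, hτ hwu, eq_iff_iff] at h
    have h' := hflip _ _ _ _ hvu hwu h
    simp only [line_eq_pair hT hvu, line_eq_pair hT hwu] at hsub ⊢
    refine ⟨{(v, w), (u, u')}, fun p hp => ?_, ?_, by simp [image_pair], by simp [image_pair]⟩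
    · have h1 := (hsub p hp).1
      have h2 := (hsub p hp).2
      have h3 := (hF p hp _ hvw).1
      simp only [mem_insert_iff, mem_singleton_iff] at h1 h2 ⊢
      simp only at h3
      have := hvu.ne
      have := hwu.ne
      rw [Prod.ext_iff, Prod.ext_iff]
      grind
    · have := hvu.ne
      have := hwu.ne
      have := hvu.ne'
      have := hwu.ne'
      rintro p (rfl | rfl) q (rfl | rfl) <;> simp_all
  · intro v w c
    have key : ∀ v, Nonempty ({u // (UG R).Adj v u ∧ R v u = c} ≃
        {B : linesAt (UG R) v // (∃ x ∈ B.1, R v x) = c}) := by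
      intro v
      refine ⟨Equiv.ofBijective (fun u => ⟨⟨_, line_mem_linesAt u.2.1⟩, (hτ u.2.1).trans u.2.2⟩)
        ⟨?_, ?_⟩⟩
      · rintro ⟨a, ha⟩ ⟨b, hb⟩ hab
        have hab' : line (UG R) v a = line (UG R) v b :=
          congrArg (fun B => B.1.1) hab
        exact Subtype.ext (((hC.line_eq_line_iff ha.1 hb.1).1 hab').resolve_right
          (not_adj_of_isTree hT ha.1 hb.1))
      · rintro ⟨⟨_, u, hu, rfl⟩, h⟩
        exact ⟨⟨u, hu, (hτ hu).symm.trans h⟩, rfl⟩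
    exact ⟨(key v).some.symm.trans ((hcount v w c).some.trans (key w).some)⟩

end Tree

section Blocks

variable {V : Type u} {R : V → V → Prop} {G : SimpleGraph V}

theorem digraphCHom_of_blockExt (hR : ∀ x, ¬ R x x) (hconn : (UG R).Connected)
    (hC : CliqueBlocks (UG R))
    (hblock : ∀ v w, ∀ B ∈ linesAt (UG R) v, ∀ B' ∈ linesAt (UG R) w, BlockExt R v w B B')
    (hcount : ∀ v w, Nonempty (linesAt (UG R) v ≃ linesAt (UG R) w)) : DigraphCHom R := by
  refine (localExt_of hC hR (fun _ _ => True) (fun _ _ _ _ _ _ _ _ => rfl)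
    (fun v w B hB B' hB' _ => hblock v w B hB B' hB') fun v w c => ?_).digraphCHom hR hconn hC
  obtain ⟨e⟩ := hcount v w
  exact ⟨e.subtypeEquiv fun _ => Iff.rfl⟩

theorem blockExt_of_equiv {v w : V} {B B' : Set V}
    (h : ∀ F : Set (V × V), PIso R F → F.Finite → (∀ p ∈ F, p.1 ∈ B ∧ p.2 ∈ B') →
      ∃ Φ : B ≃ B', (∀ a b : B, R a.1 b.1 ↔ R (Φ a).1 (Φ b).1) ∧
        ∀ p ∈ F, ∀ hp : p.1 ∈ B, (Φ ⟨p.1, hp⟩).1 = p.2) : BlockExt R v w B B' := by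
  intro F hF hfin _ hsub
  obtain ⟨Φ, hΦ, hΦF⟩ := h F hF hfin hsub
  refine ⟨range fun b : B => (b.1, (Φ b).1), ?_, ?_, ?_, ?_⟩
  · intro p hp
    exact ⟨⟨p.1, (hsub p hp).1⟩, Prod.ext rfl (hΦF p hp _)⟩
  · rintro _ ⟨a, rfl⟩ _ ⟨b, rfl⟩
    refine ⟨?_, hΦ a b⟩
    simp only [← Subtype.ext_iff, Φ.injective.eq_iff]
  · rw [← range_comp]
    exact Subtype.range_coe
  · rw [← range_comp]
    exact (Φ.surjective.range_comp Subtype.val).trans Subtype.range_coe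

theorem _root_.HomogeneousOn.tuple {B : Set V} (h : HomogeneousOn R B) {ι : Type*} [Finite ι]
    {u u' : ι → B} (hu : Function.Injective u) (hu' : Function.Injective u')
    (huu : ∀ i j, R (u i).1 (u j).1 ↔ R (u' i).1 (u' j).1) :
    ∃ ψ : Equiv.Perm B, (∀ x y : B, R (ψ x).1 (ψ y).1 ↔ R x.1 y.1) ∧ ∀ i, ψ (u i) = u' i := by
  let e : range u ≃ range u' := (Equiv.ofInjective u hu).symm.trans (Equiv.ofInjective u' hu')
  have he : ∀ i, e ⟨u i, mem_range_self i⟩ = ⟨u' i, mem_range_self i⟩ := fun i => by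
    simp only [e, Equiv.trans_apply]
    rw [Equiv.ofInjective_symm_apply hu]
    rfl
  obtain ⟨ψ, hψ, hψ'⟩ := h (range u) (range u') (finite_range u) (finite_range u') e (by
    rintro ⟨_, i, rfl⟩ ⟨_, j, rfl⟩
    rw [he, he]
    exact huu i j)
  exact ⟨ψ, hψ, fun i => by rw [hψ' ⟨u i, mem_range_self i⟩, he]⟩

theorem blockExt_of_homogeneousOn {v w : V} {B B' : Set V} (h : HomogeneousOn R B') (f : B ≃ B')
    (hf : ∀ a b : B, R a.1 b.1 ↔ R (f a).1 (f b).1) : BlockExt R v w B B' := by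
  refine blockExt_of_equiv fun F hF hfin hsub => ?_
  have := hfin.to_subtype
  obtain ⟨ψ, hψ, hψ'⟩ := h.tuple (ι := F) (u := fun p => f ⟨p.1.1, (hsub p.1 p.2).1⟩)
    (u' := fun p => ⟨p.1.2, (hsub p.1 p.2).2⟩)
    (fun p q hpq => Subtype.ext (hF.eq_of_fst p.2 q.2 (congrArg Subtype.val (f.injective hpq))))
    (fun p q hpq => Subtype.ext (hF.eq_of_snd p.2 q.2 (congrArg Subtype.val hpq)))
    (fun p q => (hf _ _).symm.trans (hF p.1 p.2 q.1 q.2).2)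
  exact ⟨f.trans ψ, fun a b => (hf a b).trans (hψ _ _).symm,
    fun p hp _ => congrArg Subtype.val (hψ' ⟨p, hp⟩)⟩

theorem blockExt_of_clique {v w : V} {B B' : Set V} (hB : Clique G B) (hB' : Clique G B')
    (f : B ≃ B') : BlockExt G.Adj v w B B' := by
  refine blockExt_of_equiv fun F hF hfin hsub => ?_
  obtain ⟨Φ, hΦ, -⟩ := exists_equiv_extending (f := fun _ : B => ()) (g := fun _ : B' => ())
    (fun c => ⟨f.subtypeEquiv fun _ => Iff.rfl⟩)
    (S := (fun p : B × B' => (p.1.1, p.2.1)) ⁻¹' F)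
    (hfin.preimage fun p _ q _ hpq => by
      simp only [Prod.mk.injEq] at hpq
      exact Prod.ext (Subtype.ext hpq.1) (Subtype.ext hpq.2))
    (fun p hp q hq => by
      rw [Subtype.ext_iff, Subtype.ext_iff]
      exact (hF _ hp _ hq).1)
    (fun _ _ => rfl)
  refine ⟨Φ, fun a b => ?_, fun p hp hpB => ?_⟩
  · have hadj : ∀ {C : Set V}, Clique G C → ∀ x y : C, G.Adj x.1 y.1 ↔ x ≠ y := fun hC x y =>
      ⟨fun h hxy => h.ne (congrArg Subtype.val hxy),
        fun h => (hC x.1 x.2 y.1 y.2).resolve_left fun e => h (Subtype.ext e)⟩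
    rw [hadj hB, hadj hB', Φ.injective.ne_iff]
  · exact congrArg Subtype.val (hΦ (⟨p.1, hpB⟩, ⟨p.2, (hsub p hp).2⟩) hp)

/-- The set `B` is connected and has no cutvertex. -/
def TwoConnected (G : SimpleGraph V) (B : Set V) : Prop :=
  (G.induce B).Connected ∧ ∀ v ∈ B, (G.induce (B \ {v})).Preconnected

theorem TwoConnected.exists_block {B : Set V} (hB : TwoConnected G B) :
    ∃ B', B ⊆ B' ∧ IsBlockOf G B' := by
  obtain ⟨M, hBM, hM⟩ := zorn_subset_nonempty {B | TwoConnected G B} (fun c hc hchain hne => by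
    refine ⟨⋃₀ c, ⟨?_, ?_⟩, fun s => subset_sUnion_of_mem⟩
    · rw [connected_iff]
      constructor
      · obtain ⟨B, hB⟩ := hne
        exact (connected_iff.1 (hc hB).1).1.mono (subset_sUnion_of_mem hB)
      · rintro x ⟨B, hB, hx⟩ y ⟨B', hB', hy⟩
        obtain ⟨K, hK, h1, h2⟩ := hchain.directedOn B hB B' hB'
        exact ((connected_iff.1 (hc hK).1).2 x (h1 hx) y (h2 hy)).mono (subset_sUnion_of_mem hK)
    · rintro v ⟨B₀, hB₀, hv⟩
      rw [preconnected_iff]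
      rintro x ⟨⟨B, hB, hx⟩, hxv⟩ y ⟨⟨B', hB', hy⟩, hyv⟩
      obtain ⟨K, hK, h1, h2⟩ := hchain.directedOn B hB B' hB'
      obtain ⟨L, hL, h3, h4⟩ := hchain.directedOn K hK B₀ hB₀
      exact (preconnected_iff.1 ((hc hL).2 v (h4 hv)) x ⟨h3 (h1 hx), hxv⟩ y
        ⟨h3 (h2 hy), hyv⟩).mono (sdiff_subset_sdiff_left (subset_sUnion_of_mem hL))) B hB
  exact ⟨M, hBM, (connected_iff.1 hM.prop.1).1, hM.prop.1, hM.prop.2,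
    fun B' hB' h1 h2 => (hM.eq_of_subset (show B' ∈ {B | TwoConnected G B} from ⟨h1, h2⟩) hB').symm⟩

theorem IndPath.twoConnected {n : ℕ} {p : ℕ → V} (hp : IndPath G n p) {x : V}
    (hx : ∀ i ≤ n, p i ≠ x) (h0 : G.Adj x (p 0)) (hn : G.Adj x (p n)) :
    TwoConnected G (insert x (p '' Iic n)) := by
  have seg : ∀ {A : Set V} {a b : ℕ}, a ≤ b → b ≤ n → (∀ i, a ≤ i → i ≤ b → p i ∈ A) →
      Joined G A (p a) (p b) := fun hab hb hA =>
    .of_fun hab hA fun i _ hi => hp.adj (by omega)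
  have hnear : ∀ y, ∀ A : Set V, insert x (p '' Iic n) \ {y} ⊆ A → x ∈ A → (y ≠ x) →
      ∀ z ∈ insert x (p '' Iic n) \ {y}, Joined G A x z := by
    rintro y A hA hxA hyx z ⟨rfl | ⟨i, hi, rfl⟩, hzy⟩
    · exact .refl hxA
    rw [mem_Iic] at hi
    by_cases hlow : ∀ j ≤ i, p j ≠ y
    · have hmem : ∀ j, 0 ≤ j → j ≤ i → p j ∈ A := fun j _ hj =>
        hA ⟨Or.inr ⟨j, hj.trans hi, rfl⟩, hlow j hj⟩
      exact (Joined.of_adj hxA (hmem 0 le_rfl (Nat.zero_le _)) h0).trans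
        (seg (Nat.zero_le _) hi hmem)
    · push Not at hlow
      obtain ⟨j, hj, rfl⟩ := hlow
      have hji : j ≠ i := by
        rintro rfl
        exact hzy rfl
      have hmem : ∀ k, i ≤ k → k ≤ n → p k ∈ A := fun k hik hk =>
        hA ⟨Or.inr ⟨k, hk, rfl⟩, (hp j k (by omega) hk).1.symm⟩
      exact (Joined.of_adj hxA (hmem n hi le_rfl) hn).trans (seg hi le_rfl hmem).symm
  have hxmem : x ∈ insert x (p '' Iic n) := mem_insert _ _
  constructor
  · refine connected_iff.2 ⟨⟨x, hxmem⟩, ?_⟩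
    have : ∀ z ∈ insert x (p '' Iic n), Joined G (insert x (p '' Iic n)) x z := by
      rintro z (rfl | ⟨i, hi, rfl⟩)
      · exact .refl hxmem
      · refine (Joined.of_adj hxmem (Or.inr ⟨0, Nat.zero_le _, rfl⟩) h0).trans
          (seg (Nat.zero_le _) hi fun j _ hj => Or.inr ⟨j, hj.trans hi, rfl⟩)
    exact fun a ha b hb => (this a ha).symm.trans (this b hb)
  · intro y _
    rw [preconnected_iff]
    by_cases hyx : y = x
    · subst hyx
      have : ∀ z ∈ insert y (p '' Iic n) \ {y}, Joined G (insert y (p '' Iic n) \ {y}) (p 0) z := by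
        rintro z ⟨rfl | ⟨i, hi, rfl⟩, hzy⟩
        · exact absurd rfl hzy
        · rw [mem_Iic] at hi
          exact seg (Nat.zero_le _) hi fun j _ hj =>
            ⟨Or.inr ⟨j, hj.trans hi, rfl⟩, hx j (hj.trans hi)⟩
      exact fun a ha b hb => (this a ha).symm.trans (this b hb)
    · have := hnear y _ Subset.rfl ⟨hxmem, fun h => hyx h.symm⟩ hyx
      exact fun a ha b hb => (this a ha).symm.trans (this b hb)

theorem cliqueBlocks_of_clique (h : ∀ B, IsBlockOf G B → Clique G B) : CliqueBlocks G := by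
  intro x y z hxy hxz hyz
  obtain ⟨n, p, rfl, rfl, hA, hp, -⟩ := exists_indPath hyz
  obtain ⟨B, hB, hblock⟩ := (hp.twoConnected hA hxy hxz).exists_block
  exact h B hblock _ (hB (Or.inr ⟨0, Nat.zero_le _, rfl⟩)) _ (hB (Or.inr ⟨n, mem_Iic.2 le_rfl, rfl⟩))

theorem CliqueBlocks.linesAt_eq (hC : CliqueBlocks G) (hnbr : ∀ v, ∃ w, G.Adj v w) (v : V) :
    linesAt G v = {B | IsBlockOf G B ∧ v ∈ B} := by
  ext B
  constructor
  · rintro ⟨u, hvu, rfl⟩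
    exact ⟨hC.isBlockOf_line hvu, left_mem_line hvu⟩
  · rintro ⟨hB, hv⟩
    obtain ⟨a, b, hab, rfl⟩ := (hC.isBlockOf_iff hnbr).1 hB
    by_cases hva : v = a
    · exact ⟨b, hva ▸ hab, by rw [hva]⟩
    · have hcl := hC.clique_line hab v hv a (left_mem_line hab)
      exact ⟨a, hcl.resolve_left hva, (hC.line_eq hab hv (left_mem_line hab) hva).symm⟩

end Blocks

section Backward

variable {V : Type u} {E : V → V → Prop}

theorem backward_tree (hD : IsDigraph E) (hT : (UG E).IsTree)
    (hout : ∀ v w : V, Nonempty ({y : V // E v y} ≃ {y : V // E w y}))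
    (hin : ∀ v w : V, Nonempty ({y : V // E y v} ≃ {y : V // E y w})) :
    DigraphCHom E ∧ GraphCHom (UG E) := by
  have key : ∀ v w (c : Prop), Nonempty ({u // (UG E).Adj v u ∧ E v u = c} ≃
      {u // (UG E).Adj w u ∧ E w u = c}) := by
    intro v w c
    by_cases hc : c
    · have h : ∀ v, ∀ u, E v u ↔ (UG E).Adj v u ∧ E v u = c := fun v u => by
        rw [UG_adj_iff hD.1]
        simp [hc]
        tauto
      exact ⟨(Equiv.subtypeEquivRight (h v)).symm.trans
        ((hout v w).some.trans (Equiv.subtypeEquivRight (h w)))⟩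
    · have h : ∀ v, ∀ u, E u v ↔ (UG E).Adj v u ∧ E v u = c := fun v u => by
        have := hD.2 v u
        rw [UG_adj_iff hD.1]
        simp [hc]
        tauto
      exact ⟨(Equiv.subtypeEquivRight (h v)).symm.trans
        ((hin v w).some.trans (Equiv.subtypeEquivRight (h w)))⟩
  have hdeg : ∀ v w, Nonempty ({u // (UG E).Adj v u} ≃ {u // (UG E).Adj w u}) := fun v w =>
    ⟨Equiv.ofFiberEquiv (f := fun u => E v u.1) (g := fun u => E w u.1) fun c =>
      (Equiv.subtypeSubtypeEquivSubtypeInter _ fun u => E v u = c).trans ((key v w c).some.trans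
        (Equiv.subtypeSubtypeEquivSubtypeInter _ fun u => E w u = c).symm)⟩
  constructor
  · refine digraphCHom_of_isTree hD.1 hT (fun v w v' w' hv hw h => ?_) key
    have := hD.2 v v'
    have := hD.2 w w'
    rw [UG_adj_iff hD.1] at hv hw
    tauto
  · rw [graphCHom_iff]
    refine digraphCHom_of_isTree (fun x => (UG E).loopless.irrefl x) (by rwa [UG_adj]) ?_ ?_
    · intro v w v' w' _ _ h
      rwa [(UG E).adj_comm v', (UG E).adj_comm w']
    · intro v w c
      rw [UG_adj]
      by_cases hc : c
      · have h : ∀ v u, (UG E).Adj v u ↔ (UG E).Adj v u ∧ (UG E).Adj v u = c := by simp [hc]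
        exact ⟨(Equiv.subtypeEquivRight (h v)).symm.trans
          ((hdeg v w).some.trans (Equiv.subtypeEquivRight (h w)))⟩
      · have h : ∀ v, IsEmpty {u // (UG E).Adj v u ∧ (UG E).Adj v u = c} := fun v =>
          ⟨fun u => hc (u.2.2 ▸ u.2.1)⟩
        have := h v
        have := h w
        exact ⟨Equiv.equivOfIsEmpty _ _⟩

theorem backward_blocks (hD : IsDigraph E) (hconn : (UG E).Connected)
    (hends : MoreThanOneEnd (UG E)) {κ lam : Cardinal.{u}}
    (hblock : ∀ B : Set V, IsBlockOf (UG E) B →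
      IsTournamentOn E B ∧ HomogeneousOn E B ∧ Cardinal.mk B = κ)
    (hiso : ∀ B B' : Set V, IsBlockOf (UG E) B → IsBlockOf (UG E) B' →
      ∃ f : B ≃ B', ∀ a b : B, E a.1 b.1 ↔ E (f a).1 (f b).1)
    (hcount : ∀ v : V, Cardinal.mk {B : Set V // IsBlockOf (UG E) B ∧ v ∈ B} = lam) :
    DigraphCHom E ∧ GraphCHom (UG E) := by
  have hcl : ∀ B, IsBlockOf (UG E) B → Clique (UG E) B := fun B hB a ha b hb => by
    rw [UG_adj_iff hD.1]
    exact or_iff_not_imp_left.2 fun h => (hblock B hB).1 a ha b hb h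
  have hC := cliqueBlocks_of_clique hcl
  have := infinite_of_ends hends
  have hnbr : ∀ v, ∃ w, (UG E).Adj v w := fun v => hconn.preconnected.exists_adj_of_nontrivial v
  have hlines : ∀ v w, Nonempty (linesAt (UG E) v ≃ linesAt (UG E) w) := fun v w => by
    rw [hC.linesAt_eq hnbr, hC.linesAt_eq hnbr]
    exact Cardinal.eq.1 ((hcount v).trans (hcount w).symm)
  have hbl : ∀ {v B}, B ∈ linesAt (UG E) v → IsBlockOf (UG E) B := by
    rintro v _ ⟨u, hvu, rfl⟩
    exact hC.isBlockOf_line hvu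
  constructor
  · refine digraphCHom_of_blockExt hD.1 hconn hC (fun v w B hB B' hB' => ?_) hlines
    obtain ⟨f, hf⟩ := hiso B B' (hbl hB) (hbl hB')
    exact blockExt_of_homogeneousOn (hblock B' (hbl hB')).2.1 f hf
  · rw [graphCHom_iff]
    refine digraphCHom_of_blockExt (fun x => (UG E).loopless.irrefl x) (by rwa [UG_adj])
      (by rwa [UG_adj]) ?_ (by rwa [UG_adj])
    rw [UG_adj]
    intro v w B hB B' hB'
    obtain ⟨f, -⟩ := hiso B B' (hbl hB) (hbl hB')
    exact blockExt_of_clique (hcl B (hbl hB)) (hcl B' (hbl hB')) f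

end Backward

end CHom

/-- Classification of the connected C-homogeneous digraphs of Type I with more
than one end. -/
theorem stmt_19 {V : Type u} (E : V → V → Prop) (hD : IsDigraph E)
    (hconn : (UG E).Connected) (hends : MoreThanOneEnd (UG E)) :
    (DigraphCHom E ∧ GraphCHom (UG E)) ↔
      (((UG E).IsTree ∧
          (∀ v w : V, Nonempty ({y : V // E v y} ≃ {y : V // E w y})) ∧
          (∀ v w : V, Nonempty ({y : V // E y v} ≃ {y : V // E y w}))) ∨
        (∃ κ lam : Cardinal.{u}, 2 ≤ lam ∧ (κ = 3 ∨ Cardinal.aleph0 ≤ κ) ∧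
          (∀ B : Set V, IsBlockOf (UG E) B →
            IsTournamentOn E B ∧ HomogeneousOn E B ∧ Cardinal.mk B = κ) ∧
          (∀ B B' : Set V, IsBlockOf (UG E) B → IsBlockOf (UG E) B' →
            ∃ f : B ≃ B', ∀ a b : B, E a.1 b.1 ↔ E (f a).1 (f b).1) ∧
          (∀ v : V, Cardinal.mk {B : Set V // IsBlockOf (UG E) B ∧ v ∈ B} = lam))) := by
  constructor
  · rintro ⟨hE, hG⟩
    exact CHom.forward hD hconn hends hE hG
  · rintro (⟨hT, hout, hin⟩ | ⟨κ, lam, -, -, hblock, hiso, hcount⟩)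
    · exact CHom.backward_tree hD hT hout hin
    · exact CHom.backward_blocks hD hconn hends hblock hiso hcount
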